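/- arXiv:1912.03376 — 2 statements merged into one kernel-verified Lean document; each statement's English description precedes it below -/
import Mathlib

section
/- Write θ = 1/k and Δ = 2/(k+1). For every ε > 0 there is a constant C (depending only on k, r, h_1,…,h_r, ε) such that for all t, γ ≥ 1 the following four bounds hold: (1) Σ_{q ≤ γ} Σ_{ν=1}^{q} |E_t(q,ν)|² ≤ C·(tγ)^ε·( γ^{2−2θ} t^{2θ} + t^{2Δ} + γ·t^{Δ} ); (2) Σ_{q ≤ γ} (1/q) Σ_{ν=1}^{q} |E_t(q,ν)|² ≤ C·(tγ)^ε·( γ^{1−2θ} t^{2θ} + t^{2Δ} ); (3) Σ_{q ≤ γ} q^{−(1−θ)} Σ_{ν=1}^{q} |E_t(q,ν)|² ≤ C·(tγ)^ε·( γ^{1−θ} t^{2θ} + t^{2Δ} + γ^{θ} t^{Δ} ); (4) Σ_{q ≤ γ} q^{−(2−θ)} Σ_{ν=1}^{q} |E_t(q,ν)|² ≤ C·(tγ)^ε·t^{2Δ}. -/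
open scoped BigOperators Classical

noncomputable section

/-- `n` is `k`-free: no `k`-th power of a prime divides `n`. -/
def KFree (k n : ℕ) : Prop := ∀ p : ℕ, p.Prime → ¬ p ^ k ∣ n

/-- The density `η(q,a)` of the `k`-free `r`-tuples (with shifts `h`) in the residue class
`a mod q`. -/
def eta (k r : ℕ) (h : Fin r → ℕ) (q a : ℕ) : ℝ :=
  ∑' d : Fin r → ℕ,
    if (∀ i, 1 ≤ d i) ∧
        (∀ i j, ((Nat.gcd (d i ^ k) (d j ^ k) : ℤ) ∣ (h i : ℤ) - (h j : ℤ))) ∧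
        (∀ i, Nat.gcd q (d i ^ k) ∣ a + h i)
    then (∏ i, (ArithmeticFunction.moebius (d i) : ℝ)) /
          ((Nat.lcm q (Finset.univ.lcm fun i => d i ^ k) : ℕ) : ℝ)
    else 0

/-- The number of `n ≤ x` with `n ∈ ℛ` (i.e. all `n + h i` are `k`-free) and
`n ≡ a (mod q)`. -/
def countR (k r : ℕ) (h : Fin r → ℕ) (x : ℝ) (q a : ℕ) : ℕ :=
  ((Finset.Icc 1 ⌊x⌋₊).filter fun n => (∀ i, KFree k (n + h i)) ∧ n % q = a % q).card

/-- The error term `E_x(q,a)`. -/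
def Ex (k r : ℕ) (h : Fin r → ℕ) (x : ℝ) (q a : ℕ) : ℝ :=
  (countR k r h x q a : ℝ) - eta k r h q a * x

/-- `R_p`: the number of distinct residues of `h_1, …, h_r` modulo `p^k`. -/
def Rp (k r : ℕ) (h : Fin r → ℕ) (p : ℕ) : ℕ :=
  ((Finset.univ : Finset (Fin r)).image fun i => h i % p ^ k).card

/-- `θ = 1/k`. -/
def theta (k : ℕ) : ℝ := 1 / k

/-- `Δ = 2/(k+1)`. -/
def Delta (k : ℕ) : ℝ := 2 / (k + 1)

theorem Nat.gcd_lcm_distrib_left (a b c : ℕ) :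
    Nat.gcd a (Nat.lcm b c) = Nat.lcm (Nat.gcd a b) (Nat.gcd a c) := by
  rcases eq_or_ne a 0 with rfl | ha
  · simp
  rcases eq_or_ne b 0 with rfl | hb
  · simpa using (Nat.lcm_eq_left (Nat.gcd_dvd_left a c)).symm
  rcases eq_or_ne c 0 with rfl | hc
  · simpa using (Nat.lcm_eq_right (Nat.gcd_dvd_left a b)).symm
  apply Nat.eq_of_factorization_eq (Nat.gcd_ne_zero_left ha)
    (Nat.lcm_ne_zero (Nat.gcd_ne_zero_left ha) (Nat.gcd_ne_zero_left ha))
  intro p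
  rw [Nat.factorization_gcd ha (Nat.lcm_ne_zero hb hc), Nat.factorization_lcm hb hc,
    Nat.factorization_lcm (Nat.gcd_ne_zero_left ha) (Nat.gcd_ne_zero_left ha),
    Nat.factorization_gcd ha hb, Nat.factorization_gcd ha hc]
  simp only [Finsupp.inf_apply, Finsupp.sup_apply]
  exact inf_sup_left _ _ _

theorem Nat.gcd_finset_lcm_dvd {ι : Type*} (s : Finset ι) (m : ι → ℕ) (a : ℕ) (x : ℤ)
    (H : ∀ i ∈ s, (Nat.gcd a (m i) : ℤ) ∣ x) : (Nat.gcd a (s.lcm m) : ℤ) ∣ x := by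
  induction s using Finset.induction_on with
  | empty => simp
  | insert j s hj ih =>
    rw [Finset.lcm_insert]
    change (Nat.gcd a (Nat.lcm (m j) (s.lcm m)) : ℤ) ∣ x
    rw [Nat.gcd_lcm_distrib_left, Int.natCast_dvd]
    apply Nat.lcm_dvd
    · exact Int.natCast_dvd.1 (H j (Finset.mem_insert_self _ _))
    · exact Int.natCast_dvd.1 (ih fun i hi => H i (Finset.mem_insert_of_mem hi))

/-- The Chinese remainder theorem for moduli that need not be coprime. -/
theorem exists_forall_dvd_sub {ι : Type*} (s : Finset ι) (m : ι → ℕ) (a : ι → ℤ)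
    (H : ∀ i ∈ s, ∀ j ∈ s, (Nat.gcd (m i) (m j) : ℤ) ∣ a i - a j) :
    ∃ x : ℤ, ∀ i ∈ s, (m i : ℤ) ∣ x - a i := by
  induction s using Finset.induction_on with
  | empty => exact ⟨0, by simp⟩
  | insert j s hj ih =>
    obtain ⟨x, hx⟩ := ih fun i hi l hl =>
      H i (Finset.mem_insert_of_mem hi) l (Finset.mem_insert_of_mem hl)
    have h1 : (Nat.gcd (m j) (s.lcm m) : ℤ) ∣ a j - x := by
      apply Nat.gcd_finset_lcm_dvd
      intro i hi
      have h2 := H j (Finset.mem_insert_self _ _) i (Finset.mem_insert_of_mem hi)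
      have h3 : (Nat.gcd (m j) (m i) : ℤ) ∣ x - a i :=
        (Int.natCast_dvd_natCast.2 (Nat.gcd_dvd_right _ _)).trans (hx i hi)
      have := dvd_sub h2 h3
      simpa using this
    obtain ⟨c, hc⟩ := h1
    have hb := Nat.gcd_eq_gcd_ab (m j) (s.lcm m)
    refine ⟨x + ((s.lcm m : ℕ) : ℤ) * (Nat.gcdB (m j) (s.lcm m) * c), fun i hi => ?_⟩
    rcases Finset.mem_insert.1 hi with rfl | hi
    · refine ⟨-(Nat.gcdA (m i) (s.lcm m) * c), ?_⟩
      have : a i = x + (Nat.gcd (m i) (s.lcm m) : ℤ) * c := by linarith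
      rw [this, hb]; ring
    · have h4 : (m i : ℤ) ∣ ((s.lcm m : ℕ) : ℤ) := Int.natCast_dvd_natCast.2 (Finset.dvd_lcm hi)
      rw [add_sub_right_comm]
      exact dvd_add (hx i hi) (h4.mul_right _)

theorem Finset.lcm_pow_eq {ι : Type*} (s : Finset ι) (d : ι → ℕ) (k : ℕ) :
    (s.lcm fun i => d i ^ k) = (s.lcm d) ^ k := by
  induction s using Finset.induction_on with
  | empty => simp
  | insert j s hj ih =>
    rw [Finset.lcm_insert, Finset.lcm_insert, ih]
    exact Nat.pow_lcm_pow

theorem sum_moebius_pow_dvd (k N : ℕ) (hk : 1 ≤ k) (hN : 1 ≤ N) :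
    ∑ d ∈ N.divisors.filter (fun d => d ^ k ∣ N), (ArithmeticFunction.moebius d : ℝ) =
      if KFree k N then 1 else 0 := by
  set S := N.divisors.filter (fun d => d ^ k ∣ N) with hS
  have hmem : ∀ d, d ∈ S ↔ d ^ k ∣ N := by
    intro d
    simp only [hS, Finset.mem_filter, Nat.mem_divisors]
    exact ⟨fun h => h.2, fun h => ⟨⟨(dvd_pow_self d (by omega)).trans h, by omega⟩, h⟩⟩
  set b := S.lcm id with hb
  have hbk : b ^ k ∣ N := by
    rw [hb, ← Finset.lcm_pow_eq]
    exact Finset.lcm_dvd fun d hd => (hmem d).1 hd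
  have hb0 : b ≠ 0 := by
    rintro h0
    rw [h0, zero_pow (by omega)] at hbk
    have := Nat.eq_zero_of_zero_dvd hbk
    omega
  have hSb : S = b.divisors := by
    ext d
    rw [Nat.mem_divisors]
    refine ⟨fun hd => ⟨Finset.dvd_lcm (f := id) hd, hb0⟩, fun hd => (hmem d).2 ?_⟩
    exact (pow_dvd_pow_of_dvd hd.1 k).trans hbk
  have hkf : KFree k N ↔ b = 1 := by
    constructor
    · intro h
      by_contra hne
      obtain ⟨p, hp, hpb⟩ := Nat.exists_prime_and_dvd hne
      exact h p hp ((pow_dvd_pow_of_dvd hpb k).trans hbk)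
    · intro h p hp hpk
      have : p ∣ b := Finset.dvd_lcm (f := id) ((hmem p).2 hpk)
      rw [h] at this
      exact hp.one_lt.ne' (Nat.dvd_one.1 this)
  have hz : ∑ d ∈ b.divisors, ArithmeticFunction.moebius d = if b = 1 then 1 else 0 := by
    have := ArithmeticFunction.coe_mul_zeta_apply (f := ArithmeticFunction.moebius) (x := b)
    rw [← this, ArithmeticFunction.moebius_mul_coe_zeta, ArithmeticFunction.one_apply]
  rw [hSb, ← Int.cast_sum, hz]
  simp [hkf]

theorem exists_card_divisors_le_mul_rpow (ε : ℝ) (hε : 0 < ε) :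
    ∃ C : ℝ, 1 ≤ C ∧ ∀ n : ℕ, 1 ≤ n → (n.divisors.card : ℝ) ≤ C * (n : ℝ) ^ ε := by
  obtain ⟨P, hP⟩ := exists_nat_ge ((2 : ℝ) ^ (1 / ε))
  set A : ℝ := 1 + 1 / (Real.log 2 * ε) with hA
  have hl2 : 0 < Real.log 2 := Real.log_pos (by norm_num)
  have hA1 : 1 ≤ A := by
    have : 0 < 1 / (Real.log 2 * ε) := by positivity
    linarith
  refine ⟨A ^ P, one_le_pow₀ hA1, fun n hn => ?_⟩
  have hn0 : n ≠ 0 := by omega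
  have key : ∀ p ∈ n.primeFactors, ((n.factorization p + 1 : ℕ) : ℝ) ≤
      (if p < P then A else 1) * ((p : ℝ) ^ n.factorization p) ^ ε := by
    intro p hp
    have hpp := Nat.prime_of_mem_primeFactors hp
    have hp2 : (2 : ℝ) ≤ p := by exact_mod_cast hpp.two_le
    set a := n.factorization p
    have hr : ((p : ℝ) ^ a) ^ ε = ((p : ℝ) ^ ε) ^ a := by
      rw [← Real.rpow_natCast, ← Real.rpow_mul (by positivity), mul_comm,
        Real.rpow_mul (by positivity), Real.rpow_natCast]
    rw [hr]
    push_cast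
    split_ifs with hlt
    · have h1 : 1 + Real.log 2 * ε * a ≤ ((p : ℝ) ^ ε) ^ a := by
        have h2 : ((2 : ℝ) ^ ε) ^ a ≤ ((p : ℝ) ^ ε) ^ a := by gcongr
        refine le_trans ?_ h2
        rw [← Real.rpow_natCast, ← Real.rpow_mul (by positivity),
          Real.rpow_def_of_pos (by norm_num)]
        have := Real.add_one_le_exp (Real.log 2 * (ε * a))
        linarith
      have h3 : (a : ℝ) + 1 ≤ A * (1 + Real.log 2 * ε * a) := by
        have h4 : 1 / (Real.log 2 * ε) * (Real.log 2 * ε * a) = a := by field_simp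
        have h5 : 0 ≤ 1 / (Real.log 2 * ε) := by positivity
        have h6 : 0 ≤ Real.log 2 * ε * a := by positivity
        rw [hA]
        nlinarith
      exact h3.trans (by gcongr)
    · have h1 : (2 : ℝ) ≤ (p : ℝ) ^ ε := by
        have h2 : (2 : ℝ) ^ (1 / ε) ≤ p := hP.trans (by exact_mod_cast not_lt.1 hlt)
        calc (2 : ℝ) = ((2 : ℝ) ^ (1 / ε)) ^ ε := by
              rw [← Real.rpow_mul (by norm_num), one_div_mul_cancel hε.ne', Real.rpow_one]
          _ ≤ _ := by gcongr
      have h3 : (2 : ℝ) ^ a ≤ ((p : ℝ) ^ ε) ^ a := by gcongr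
      have h4 : (a : ℝ) + 1 ≤ 2 ^ a := by exact_mod_cast Nat.lt_two_pow_self (n := a)
      linarith
  rw [Nat.card_divisors hn0, Nat.cast_prod]
  refine (Finset.prod_le_prod (fun _ _ => by positivity) key).trans ?_
  rw [Finset.prod_mul_distrib]
  have h1 : ∏ p ∈ n.primeFactors, (if p < P then A else 1) ≤ A ^ P := by
    rw [← Finset.prod_filter, Finset.prod_const]
    apply pow_le_pow_right₀ hA1
    calc _ ≤ (Finset.range P).card := Finset.card_le_card (by
          intro p hp; simpa using (Finset.mem_filter.1 hp).2)
      _ = P := Finset.card_range P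
  have h2 : ∏ p ∈ n.primeFactors, ((p : ℝ) ^ n.factorization p) ^ ε = (n : ℝ) ^ ε := by
    rw [Real.finsetProd_rpow _ _ (fun _ _ => by positivity)]
    congr 1
    conv_rhs => rw [← Nat.prod_factorization_pow_eq_self hn0]
    rw [Finsupp.prod, Nat.cast_prod]
    simp
  rw [h2]
  gcongr

theorem exists_card_divisors_pow_mul_le (r k : ℕ) (hk : 1 ≤ k) (ε : ℝ) (hε : 0 < ε) :
    ∃ C : ℝ, 1 ≤ C ∧ ∀ n : ℕ, 1 ≤ n →
      (n.divisors.card : ℝ) ^ r * ((n ^ k).divisors.card : ℝ) ≤ C * (n : ℝ) ^ ε := by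
  have hrk : (0 : ℝ) < r + k := by
    have : (1 : ℝ) ≤ k := by exact_mod_cast hk
    positivity
  obtain ⟨C, hC, H⟩ := exists_card_divisors_le_mul_rpow (ε / (r + k)) (by positivity)
  refine ⟨C ^ (r + 1), one_le_pow₀ hC, fun n hn => ?_⟩
  have hn0 : (0 : ℝ) < n := by exact_mod_cast hn
  have h1 := H n hn
  have h2 := H (n ^ k) (Nat.one_le_pow _ _ hn)
  calc (n.divisors.card : ℝ) ^ r * ((n ^ k).divisors.card : ℝ)
      ≤ (C * (n : ℝ) ^ (ε / (r + k))) ^ r * (C * ((n ^ k : ℕ) : ℝ) ^ (ε / (r + k))) := by gcongr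
    _ = C ^ (r + 1) * (((n : ℝ) ^ (ε / (r + k))) ^ r * ((n : ℝ) ^ k) ^ (ε / (r + k))) := by
        push_cast; ring
    _ = C ^ (r + 1) * (n : ℝ) ^ ε := by
        rw [← Real.rpow_natCast (n : ℝ) k, ← Real.rpow_mul hn0.le, ← Real.rpow_natCast _ r,
          ← Real.rpow_mul hn0.le, ← Real.rpow_add hn0]
        congr 2
        field_simp

theorem one_le_lcm_of_forall_one_le {r : ℕ} {d : Fin r → ℕ} (hd : ∀ i, 1 ≤ d i) :
    1 ≤ Finset.univ.lcm d := by
  refine Nat.one_le_iff_ne_zero.2 fun h => ?_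
  rw [Finset.lcm_eq_zero_iff] at h
  obtain ⟨i, -, hi⟩ := h
  have := hd i
  omega

theorem sum_tuples_le_sum_lcm {r : ℕ} (F : Finset (Fin r → ℕ)) (hF : ∀ d ∈ F, ∀ i, 1 ≤ d i)
    (φ : ℕ → ℝ) (hφ : ∀ m, 0 ≤ φ m) :
    ∑ d ∈ F, φ (Finset.univ.lcm d) ≤
      ∑ m ∈ F.image (fun d => Finset.univ.lcm d), (m.divisors.card : ℝ) ^ r * φ m := by
  rw [← Finset.sum_fiberwise_of_maps_to (t := F.image (fun d => Finset.univ.lcm d))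
    (g := fun d => Finset.univ.lcm d) (fun d hd => Finset.mem_image_of_mem _ hd)]
  refine Finset.sum_le_sum fun m hm => ?_
  obtain ⟨d₀, hd₀, rfl⟩ := Finset.mem_image.1 hm
  set m := Finset.univ.lcm d₀ with hm'
  have hm1 : 1 ≤ m := one_le_lcm_of_forall_one_le (hF d₀ hd₀)
  have h1 : ∑ d ∈ F with Finset.univ.lcm d = m, φ (Finset.univ.lcm d) =
      ∑ d ∈ F with Finset.univ.lcm d = m, φ m :=
    Finset.sum_congr rfl fun d hd => by rw [(Finset.mem_filter.1 hd).2]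
  rw [h1, Finset.sum_const, nsmul_eq_mul]
  refine mul_le_mul_of_nonneg_right ?_ (hφ m)
  have h2 : (F.filter fun d => Finset.univ.lcm d = m) ⊆
      Fintype.piFinset (fun _ : Fin r => m.divisors) := by
    intro d hd
    rw [Fintype.mem_piFinset]
    intro i
    rw [Nat.mem_divisors]
    refine ⟨?_, by omega⟩
    rw [← (Finset.mem_filter.1 hd).2]
    exact Finset.dvd_lcm (Finset.mem_univ i)
  have h3 := Finset.card_le_card h2
  rw [Fintype.card_piFinset_const] at h3
  exact_mod_cast h3

theorem exists_card_tuples_lcm_le (r : ℕ) (ε : ℝ) (hε : 0 < ε) :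
    ∃ C : ℝ, 1 ≤ C ∧ ∀ z : ℝ, 0 < z → ∀ F : Finset (Fin r → ℕ),
      (∀ d ∈ F, (∀ i, 1 ≤ d i) ∧ (Finset.univ.lcm d : ℕ) ≤ z) →
        (F.card : ℝ) ≤ C * z * z ^ ε := by
  obtain ⟨C, hC, H⟩ := exists_card_divisors_pow_mul_le r 1 le_rfl ε hε
  refine ⟨C, hC, fun z hz F hF => ?_⟩
  have h1 := sum_tuples_le_sum_lcm F (fun d hd => (hF d hd).1) (fun _ => 1) (by simp)
  simp only [Finset.sum_const, nsmul_eq_mul, mul_one] at h1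
  refine h1.trans ?_
  have hmem : ∀ m ∈ F.image (fun d => Finset.univ.lcm d), 1 ≤ m ∧ (m : ℝ) ≤ z := by
    intro m hm
    obtain ⟨d, hd, rfl⟩ := Finset.mem_image.1 hm
    exact ⟨one_le_lcm_of_forall_one_le (hF d hd).1, (hF d hd).2⟩
  have h2 : ∀ m ∈ F.image (fun d => Finset.univ.lcm d),
      (m.divisors.card : ℝ) ^ r ≤ C * z ^ ε := by
    intro m hm
    obtain ⟨hm1, hmz⟩ := hmem m hm
    have h3 := H m hm1
    have h4 : (1 : ℝ) ≤ ((m ^ 1).divisors.card : ℝ) := by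
      have : 0 < (m ^ 1).divisors.card := Finset.card_pos.2 ⟨1, by simp; omega⟩
      exact_mod_cast this
    calc (m.divisors.card : ℝ) ^ r ≤ (m.divisors.card : ℝ) ^ r * ((m ^ 1).divisors.card : ℝ) :=
          le_mul_of_one_le_right (by positivity) h4
      _ ≤ C * (m : ℝ) ^ ε := h3
      _ ≤ _ := by gcongr
  refine (Finset.sum_le_sum h2).trans ?_
  rw [Finset.sum_const, nsmul_eq_mul]
  have h5 : ((F.image (fun d => Finset.univ.lcm d)).card : ℝ) ≤ z := by
    have h6 : F.image (fun d => Finset.univ.lcm d) ⊆ Finset.Icc 1 ⌊z⌋₊ := by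
      intro m hm
      obtain ⟨hm1, hmz⟩ := hmem m hm
      exact Finset.mem_Icc.2 ⟨hm1, Nat.le_floor hmz⟩
    have h7 := Finset.card_le_card h6
    rw [Nat.card_Icc, Nat.add_sub_cancel] at h7
    exact (Nat.cast_le.2 h7).trans (Nat.floor_le hz.le)
  have h8 : (0 : ℝ) ≤ C * z ^ ε := by positivity
  nlinarith [mul_le_mul_of_nonneg_right h5 h8]

theorem exists_sum_tuples_lcm_tail_le (r k : ℕ) (hk : 2 ≤ k) (ε : ℝ) (hε : 0 < ε) (hε1 : ε ≤ 1) :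
    ∃ C : ℝ, 1 ≤ C ∧ ∀ y : ℝ, 0 < y → ∀ F : Finset (Fin r → ℕ),
      (∀ d ∈ F, (∀ i, 1 ≤ d i) ∧ y < (Finset.univ.lcm d : ℕ)) →
        ∑ d ∈ F, (((Finset.univ.lcm d) ^ k).divisors.card : ℝ) /
          ((Finset.univ.lcm d : ℕ) : ℝ) ^ k ≤ C * y ^ (1 - (k : ℝ)) * y ^ ε := by
  obtain ⟨C, hC, H⟩ := exists_card_divisors_pow_mul_le r k (by omega) (ε / 2) (by positivity)
  have hs : Summable fun n : ℕ => (n : ℝ) ^ (-1 - ε / 2) :=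
    Real.summable_nat_rpow.2 (by linarith)
  set T := ∑' n : ℕ, (n : ℝ) ^ (-1 - ε / 2) with hT
  have hT1 : 1 ≤ T := by
    have := hs.le_tsum 1 (fun _ _ => by positivity)
    simpa using this
  refine ⟨C * T, one_le_mul_of_one_le_of_one_le hC hT1, fun y hy F hF => ?_⟩
  have h1 := sum_tuples_le_sum_lcm F (fun d hd => (hF d hd).1)
    (fun m => ((m ^ k).divisors.card : ℝ) / (m : ℝ) ^ k) (fun m => by positivity)
  refine h1.trans ?_
  have h2 : ∀ m ∈ F.image (fun d => Finset.univ.lcm d),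
      (m.divisors.card : ℝ) ^ r * (((m ^ k).divisors.card : ℝ) / (m : ℝ) ^ k) ≤
        (C * y ^ (1 - (k : ℝ)) * y ^ ε) * (m : ℝ) ^ (-1 - ε / 2) := by
    intro m hm
    obtain ⟨d, hd, rfl⟩ := Finset.mem_image.1 hm
    obtain ⟨hd1, hdy⟩ := hF d hd
    have hm1 := one_le_lcm_of_forall_one_le hd1
    set m := Finset.univ.lcm d
    have hm0 : (0 : ℝ) < m := by exact_mod_cast hm1
    have hk2 : (2 : ℝ) ≤ k := by exact_mod_cast hk
    calc _ = (m.divisors.card : ℝ) ^ r * ((m ^ k).divisors.card : ℝ) * (m : ℝ) ^ (-(k : ℝ)) := by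
          rw [Real.rpow_neg hm0.le, Real.rpow_natCast]; field_simp
      _ ≤ C * (m : ℝ) ^ (ε / 2) * (m : ℝ) ^ (-(k : ℝ)) := 
          mul_le_mul_of_nonneg_right (H m hm1) (by positivity)
      _ = C * ((m : ℝ) ^ (1 - (k : ℝ) + ε) * (m : ℝ) ^ (-1 - ε / 2)) := by
          rw [mul_assoc, ← Real.rpow_add hm0, ← Real.rpow_add hm0]; congr 2; ring
      _ ≤ C * (y ^ (1 - (k : ℝ) + ε) * (m : ℝ) ^ (-1 - ε / 2)) := by
          gcongr C * (?_ * _)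
          exact Real.rpow_le_rpow_of_nonpos hy hdy.le (by linarith)
      _ = _ := by rw [Real.rpow_add hy]; ring
  refine (Finset.sum_le_sum h2).trans ?_
  rw [← Finset.mul_sum]
  have h3 : ∑ m ∈ F.image (fun d => Finset.univ.lcm d), (m : ℝ) ^ (-1 - ε / 2) ≤ T :=
    hs.sum_le_tsum _ fun _ _ => by positivity
  calc _ ≤ (C * y ^ (1 - (k : ℝ)) * y ^ ε) * T := by gcongr
    _ = _ := by ring

/-- The weight of the tuple `d` in `eta`, without the Möbius factor. -/
def tupleDensity (k r : ℕ) (h : Fin r → ℕ) (q a : ℕ) (d : Fin r → ℕ) : ℝ :=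
  if (∀ i, 1 ≤ d i) ∧
      (∀ i j, ((Nat.gcd (d i ^ k) (d j ^ k) : ℤ) ∣ (h i : ℤ) - (h j : ℤ))) ∧
      (∀ i, Nat.gcd q (d i ^ k) ∣ a + h i)
  then 1 / ((Nat.lcm q (Finset.univ.lcm fun i => d i ^ k) : ℕ) : ℝ)
  else 0

/-- The number of `n ≤ t` in the class `a mod q` with `d i ^ k ∣ n + h i` for all `i`. -/
def tupleCount (k r : ℕ) (h : Fin r → ℕ) (t : ℝ) (q a : ℕ) (d : Fin r → ℕ) : ℕ :=
  ((Finset.Icc 1 ⌊t⌋₊).filter fun n => (∀ i, d i ^ k ∣ n + h i) ∧ n % q = a % q).card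

theorem tupleDensity_nonneg (k r : ℕ) (h : Fin r → ℕ) (q a : ℕ) (d : Fin r → ℕ) :
    0 ≤ tupleDensity k r h q a d := by
  unfold tupleDensity; split_ifs <;> positivity

theorem eta_eq_tsum (k r : ℕ) (h : Fin r → ℕ) (q a : ℕ) :
    eta k r h q a = ∑' d : Fin r → ℕ,
      (∏ i, (ArithmeticFunction.moebius (d i) : ℝ)) * tupleDensity k r h q a d := by
  unfold eta tupleDensity
  congr 1
  funext d
  split_ifs <;> simp [div_eq_mul_inv]

theorem exists_solution_of_gcd_dvd {k r : ℕ} {h : Fin r → ℕ} {q a : ℕ} {d : Fin r → ℕ}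
    (h1 : ∀ i j, ((Nat.gcd (d i ^ k) (d j ^ k) : ℤ) ∣ (h i : ℤ) - (h j : ℤ)))
    (h2 : ∀ i, Nat.gcd q (d i ^ k) ∣ a + h i) :
    ∃ x : ℤ, (q : ℤ) ∣ x - a ∧ ∀ i, ((d i ^ k : ℕ) : ℤ) ∣ x + h i := by
  have h2' : ∀ i, (Nat.gcd q (d i ^ k) : ℤ) ∣ (a : ℤ) + h i := fun i => by
    exact_mod_cast Int.natCast_dvd_natCast.2 (h2 i)
  obtain ⟨x, hx⟩ := exists_forall_dvd_sub (Finset.univ : Finset (Option (Fin r)))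
    (fun o => o.elim q fun i => d i ^ k) (fun o => o.elim (a : ℤ) fun i => -(h i : ℤ)) (by
      rintro (_ | i) - (_ | j) -
      · simp
      · simpa using h2' j
      · have := h2' i
        rw [Nat.gcd_comm, ← dvd_neg, neg_add'] at this
        simpa [sub_eq_add_neg, add_comm] using this
      · have := h1 j i
        rw [Nat.gcd_comm] at this
        simpa [sub_eq_add_neg, add_comm] using this)
  refine ⟨x, by simpa using hx none (Finset.mem_univ _), fun i => ?_⟩
  simpa using hx (some i) (Finset.mem_univ _)

theorem lcm_pow_pos {k r : ℕ} {d : Fin r → ℕ} (hd : ∀ i, 1 ≤ d i) :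
    0 < Finset.univ.lcm fun i => d i ^ k :=
  one_le_lcm_of_forall_one_le fun i => Nat.one_le_pow _ _ (hd i)

theorem abs_card_modEq_sub_div_le (t : ℝ) (ht : 0 ≤ t) (L v : ℕ) (hL : 0 < L) :
    |(((Finset.Ioc 0 ⌊t⌋₊).filter fun n => n ≡ v [MOD L]).card : ℝ) - t / L| ≤ 2 := by
  have h1 := Nat.Ioc_filter_modEq_card 0 ⌊t⌋₊ hL v
  have hL0 : (0 : ℝ) < L := by exact_mod_cast hL
  have hL1 : (1 : ℝ) ≤ L := by exact_mod_cast hL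
  have e1 : ((⌊t⌋₊ : ℚ) - v) / L = (⌊t⌋₊ : ℚ) / L + ((0 : ℕ) - v) / L := by push_cast; ring
  set b : ℚ := ((0 : ℕ) - (v : ℚ)) / L
  set c : ℚ := (⌊t⌋₊ : ℚ) / L with hc
  have hc0 : 0 ≤ c := by positivity
  rw [e1, max_eq_left (by
    have : ⌊b⌋ ≤ ⌊c + b⌋ := Int.floor_le_floor (by linarith)
    linarith)] at h1
  have f1 := Int.floor_le b
  have f2 := Int.lt_floor_add_one b
  have f3 := Int.floor_le (c + b)
  have f4 := Int.lt_floor_add_one (c + b)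
  set K := ((Finset.Ioc 0 ⌊t⌋₊).filter fun n => n ≡ v [MOD L]).card
  have h2 : (K : ℚ) = ⌊c + b⌋ - ⌊b⌋ := by exact_mod_cast h1
  have h3 : (K : ℚ) ≤ c + 1 := by linarith
  have h4 : c - 1 ≤ (K : ℚ) := by linarith
  have hcr : ((c : ℚ) : ℝ) = (⌊t⌋₊ : ℝ) / L := by rw [hc]; push_cast; rfl
  have h5 : (K : ℝ) ≤ (⌊t⌋₊ : ℝ) / L + 1 := by rw [← hcr]; exact_mod_cast h3
  have h6 : (⌊t⌋₊ : ℝ) / L - 1 ≤ (K : ℝ) := by rw [← hcr]; exact_mod_cast h4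
  have h7 : (⌊t⌋₊ : ℝ) / L ≤ t / L := by gcongr; exact Nat.floor_le ht
  have h8 : t / L ≤ (⌊t⌋₊ : ℝ) / L + 1 := by
    rw [div_add_one hL0.ne']
    gcongr
    linarith [Nat.lt_floor_add_one t]
  rw [abs_le]
  constructor <;> linarith

theorem abs_tupleCount_sub_le {k r : ℕ} {h : Fin r → ℕ} {t : ℝ} (ht : 0 ≤ t) {q a : ℕ}
    (hq : 1 ≤ q) {d : Fin r → ℕ} (hd : ∀ i, 1 ≤ d i) :
    |(tupleCount k r h t q a d : ℝ) - tupleDensity k r h q a d * t| ≤ 2 := by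
  unfold tupleCount tupleDensity
  split_ifs with hc
  · obtain ⟨-, h1, h2⟩ := hc
    obtain ⟨x, hx1, hx2⟩ := exists_solution_of_gcd_dvd h1 h2
    set M := Finset.univ.lcm fun i => d i ^ k with hM
    have hM0 : 0 < M := lcm_pow_pos hd
    have hL : 0 < Nat.lcm q M := Nat.lcm_pos (by omega) hM0
    set L := Nat.lcm q M
    set v := (x % (L : ℤ)).toNat with hv
    have hvx : ((L : ℕ) : ℤ) ∣ x - v := by
      rw [hv, Int.toNat_of_nonneg (Int.emod_nonneg _ (by exact_mod_cast hL.ne'))]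
      exact Int.dvd_self_sub_emod
    have key : ((Finset.Icc 1 ⌊t⌋₊).filter fun n => (∀ i, d i ^ k ∣ n + h i) ∧ n % q = a % q) =
        (Finset.Ioc 0 ⌊t⌋₊).filter fun n => n ≡ v [MOD L] := by
      ext n
      simp only [Finset.mem_filter, Finset.mem_Icc, Finset.mem_Ioc]
      refine and_congr (by omega) ?_
      have e1 : n % q = a % q ↔ (q : ℤ) ∣ n - x := by
        change n ≡ a [MOD q] ↔ _
        rw [Nat.ModEq.comm, Nat.modEq_iff_dvd]
        rw [show (n : ℤ) - a = (n - x) + (x - a) by ring, dvd_add_left hx1]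
      have e2 : (∀ i, d i ^ k ∣ n + h i) ↔ (M : ℤ) ∣ n - x := by
        rw [Int.natCast_dvd, hM, Finset.lcm_dvd_iff]
        refine forall_congr' fun i => ?_
        simp only [Finset.mem_univ, true_imp_iff]
        rw [← Int.natCast_dvd, ← Int.natCast_dvd_natCast]
        rw [show ((n + h i : ℕ) : ℤ) = (n - x) + (x + h i) by push_cast; ring,
          dvd_add_left (hx2 i)]
      rw [e1, e2, Nat.ModEq.comm, Nat.modEq_iff_dvd,
        show (n : ℤ) - v = (n - x) + (x - v) by ring, dvd_add_left hvx]
      simp only [Int.natCast_dvd]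
      rw [Nat.lcm_dvd_iff]
      tauto
    rw [key, one_div, inv_mul_eq_div]
    exact abs_card_modEq_sub_div_le t ht L v hL
  · rw [Finset.filter_eq_empty_iff.2]
    · simp
    · rintro n - ⟨h1, h2⟩
      refine hc ⟨hd, fun i j => ?_, fun i => ?_⟩
      · have a1 : (Nat.gcd (d i ^ k) (d j ^ k) : ℤ) ∣ ((n + h i : ℕ) : ℤ) :=
          Int.natCast_dvd_natCast.2 ((Nat.gcd_dvd_left _ _).trans (h1 i))
        have a2 : (Nat.gcd (d i ^ k) (d j ^ k) : ℤ) ∣ ((n + h j : ℕ) : ℤ) :=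
          Int.natCast_dvd_natCast.2 ((Nat.gcd_dvd_right _ _).trans (h1 j))
        have := dvd_sub a1 a2
        push_cast at this
        simpa using this
      · have a1 : n ≡ a [MOD Nat.gcd q (d i ^ k)] :=
          Nat.ModEq.of_dvd (Nat.gcd_dvd_left _ _) h2
        have a2 : n + h i ≡ a + h i [MOD Nat.gcd q (d i ^ k)] := a1.add_right _
        exact (a2.dvd_iff dvd_rfl).1 ((Nat.gcd_dvd_right _ _).trans (h1 i))

theorem tupleDensity_le (k r : ℕ) (h : Fin r → ℕ) {q : ℕ} (hq : 1 ≤ q) (a : ℕ) (d : Fin r → ℕ) :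
    tupleDensity k r h q a d ≤
      if ∀ i, 1 ≤ d i then 1 / ((Finset.univ.lcm d : ℕ) : ℝ) ^ k else 0 := by
  unfold tupleDensity
  by_cases hd : ∀ i, 1 ≤ d i
  · rw [if_pos hd]
    split_ifs
    · have hM := lcm_pow_pos (k := k) hd
      rw [Finset.lcm_pow_eq] at hM ⊢
      have : (Finset.univ.lcm d) ^ k ≤ Nat.lcm q ((Finset.univ.lcm d) ^ k) :=
        Nat.le_of_dvd (Nat.lcm_pos (by omega) hM) (Nat.dvd_lcm_right _ _)
      have h0 : (0 : ℝ) < ((Finset.univ.lcm d : ℕ) : ℝ) ^ k := by exact_mod_cast hM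
      gcongr
      exact_mod_cast this
    · positivity
  · rw [if_neg hd, if_neg fun h => hd h.1]

theorem card_filter_modEq_of_dvd {q g : ℕ} (hg : 0 < g) (hgq : g ∣ q) (v : ℕ) :
    ((Finset.Ioc 0 q).filter fun n => n ≡ v [MOD g]).card = q / g := by
  obtain ⟨c, rfl⟩ := hgq
  have h1 := Nat.Ioc_filter_modEq_card 0 (g * c) hg v
  have hg0 : (g : ℚ) ≠ 0 := by exact_mod_cast hg.ne'
  have e1 : (((g * c : ℕ) : ℚ) - v) / g = (c : ℚ) + ((0 : ℕ) - v) / g := by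
    push_cast; field_simp; ring
  rw [e1, Int.floor_natCast_add, add_sub_cancel_right, max_eq_left (by positivity)] at h1
  rw [Nat.mul_div_cancel_left _ hg]
  exact_mod_cast h1

theorem sum_tupleDensity_sq_le (k r : ℕ) (h : Fin r → ℕ) {q : ℕ} (hq : 1 ≤ q) {d : Fin r → ℕ}
    (hd : ∀ i, 1 ≤ d i) :
    ∑ a ∈ Finset.Icc 1 q, tupleDensity k r h q a d ^ 2 ≤
      (Nat.gcd q ((Finset.univ.lcm d) ^ k) : ℝ) /
        (q * (((Finset.univ.lcm d : ℕ) : ℝ) ^ k) ^ 2) := by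
  have hM0 := lcm_pow_pos (k := k) hd
  set M := Finset.univ.lcm fun i => d i ^ k with hM
  have hMd : M = (Finset.univ.lcm d) ^ k := Finset.lcm_pow_eq _ _ _
  rw [← hMd, ← Nat.cast_pow, ← hMd]
  set g := Nat.gcd q M with hg
  have hg0 : 0 < g := Nat.gcd_pos_of_pos_left _ (by omega)
  set S := (Finset.Icc 1 q).filter fun a =>
    (∀ i j, ((Nat.gcd (d i ^ k) (d j ^ k) : ℤ) ∣ (h i : ℤ) - (h j : ℤ))) ∧
      (∀ i, Nat.gcd q (d i ^ k) ∣ a + h i) with hS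
  have h1 : ∑ a ∈ Finset.Icc 1 q, tupleDensity k r h q a d ^ 2 =
      S.card * (1 / (Nat.lcm q M : ℝ)) ^ 2 := by
    rw [← nsmul_eq_mul, ← Finset.sum_const, hS, Finset.sum_filter]
    refine Finset.sum_congr rfl fun a _ => ?_
    unfold tupleDensity
    simp only [hd, implies_true, true_and]
    split_ifs <;> simp [hM]
  have h2 : S.card ≤ q / g := by
    rcases S.eq_empty_or_nonempty with hE | ⟨a₀, ha₀⟩
    · simp [hE]
    · rw [← card_filter_modEq_of_dvd hg0 (Nat.gcd_dvd_left q M) a₀]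
      refine Finset.card_le_card fun a ha => ?_
      obtain ⟨ha1, ha2, ha3⟩ := Finset.mem_filter.1 ha
      obtain ⟨-, hb2, hb3⟩ := Finset.mem_filter.1 ha₀
      obtain ⟨x, hx1, hx2⟩ := exists_solution_of_gcd_dvd ha2 ha3
      obtain ⟨z, hz1, hz2⟩ := exists_solution_of_gcd_dvd hb2 hb3
      rw [Finset.mem_Icc] at ha1
      refine Finset.mem_filter.2 ⟨Finset.mem_Ioc.2 (by omega), ?_⟩
      rw [Nat.ModEq.comm, Nat.modEq_iff_dvd]
      have hMxz : (M : ℤ) ∣ x - z := by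
        rw [Int.natCast_dvd, hM, Finset.lcm_dvd_iff]
        intro i _
        rw [← Int.natCast_dvd]
        have := dvd_sub (hx2 i) (hz2 i)
        simpa using this
      have c1 : (g : ℤ) ∣ x - z := (Int.natCast_dvd_natCast.2 (Nat.gcd_dvd_right _ _)).trans hMxz
      have c2 : (g : ℤ) ∣ x - a := (Int.natCast_dvd_natCast.2 (Nat.gcd_dvd_left _ _)).trans hx1
      have c3 : (g : ℤ) ∣ z - a₀ := (Int.natCast_dvd_natCast.2 (Nat.gcd_dvd_left _ _)).trans hz1
      rw [show (a : ℤ) - a₀ = (x - z) - (x - a) + (z - a₀) by ring]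
      exact dvd_add (dvd_sub c1 c2) c3
  have h3 : (S.card : ℝ) ≤ (q : ℝ) / g := (Nat.cast_le.2 h2).trans Nat.cast_div_le
  have h4 : (g : ℝ) * Nat.lcm q M = q * M := by exact_mod_cast Nat.gcd_mul_lcm q M
  have hgr : (0 : ℝ) < g := by exact_mod_cast hg0
  have hqr : (0 : ℝ) < q := by exact_mod_cast hq
  have hMr : (0 : ℝ) < M := by exact_mod_cast hM0
  have h5 : (Nat.lcm q M : ℝ) = q * M / g := by rw [eq_div_iff hgr.ne', mul_comm]; exact h4
  rw [h1, h5]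
  calc (S.card : ℝ) * (1 / (q * M / g : ℝ)) ^ 2 ≤ (q : ℝ) / g * (1 / (q * M / g : ℝ)) ^ 2 := by
        gcongr
    _ = _ := by field_simp

theorem sum_gcd_div_le (N a : ℕ) (ha : a ≠ 0) :
    ∑ q ∈ Finset.Icc 1 N, (Nat.gcd q a : ℝ) / q ≤ a.divisors.card * (1 + Real.log N) := by
  have h1 : ∀ q ∈ Finset.Icc 1 N, (Nat.gcd q a : ℝ) / q ≤
      ∑ e ∈ a.divisors, if e ∣ q then (e : ℝ) / q else 0 := by
    intro q hq
    have hm : Nat.gcd q a ∈ a.divisors := Nat.mem_divisors.2 ⟨Nat.gcd_dvd_right _ _, ha⟩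
    refine le_trans ?_ (Finset.single_le_sum (fun e _ => ?_) hm)
    · rw [if_pos (Nat.gcd_dvd_left _ _)]
    · split_ifs <;> positivity
  refine (Finset.sum_le_sum h1).trans ?_
  rw [Finset.sum_comm, ← nsmul_eq_mul, ← Finset.sum_const]
  refine Finset.sum_le_sum fun e he => ?_
  have he0 : 0 < e := Nat.pos_of_mem_divisors he
  have h2 : (Finset.Icc 1 N).filter (fun q => e ∣ q) ⊆ (Finset.Icc 1 N).image (fun j => e * j) := by
    intro q hq
    obtain ⟨hq1, c, rfl⟩ := Finset.mem_filter.1 hq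
    rw [Finset.mem_Icc] at hq1
    refine Finset.mem_image.2 ⟨c, Finset.mem_Icc.2 ⟨?_, ?_⟩, rfl⟩
    · exact Nat.pos_of_mul_pos_left (Nat.lt_of_succ_le hq1.1)
    · exact (Nat.le_mul_of_pos_left c he0).trans hq1.2
  rw [← Finset.sum_filter]
  refine (Finset.sum_le_sum_of_subset_of_nonneg h2 fun _ _ _ => by positivity).trans ?_
  rw [Finset.sum_image fun x _ y _ hxy => Nat.eq_of_mul_eq_mul_left he0 hxy]
  have h3 := harmonic_le_one_add_log N
  rw [harmonic_eq_sum_Icc] at h3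
  push_cast at h3
  refine le_trans (le_of_eq ?_) h3
  refine Finset.sum_congr rfl fun j _ => ?_
  have : (e : ℝ) ≠ 0 := by exact_mod_cast he0.ne'
  push_cast
  field_simp

theorem sum_Icc_moebius_pow_dvd {k N K : ℕ} (hk : 1 ≤ k) (hN : 1 ≤ N) (hK : N ≤ K) :
    (∑ e ∈ Finset.Icc 1 K, if e ^ k ∣ N then (ArithmeticFunction.moebius e : ℝ) else 0) =
      if KFree k N then 1 else 0 := by
  rw [← sum_moebius_pow_dvd k N hk hN, ← Finset.sum_filter]
  refine Finset.sum_congr ?_ fun _ _ => rfl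
  ext e
  simp only [Finset.mem_filter, Finset.mem_Icc, Nat.mem_divisors]
  constructor
  · rintro ⟨-, h⟩
    exact ⟨⟨(dvd_pow_self e (by omega)).trans h, by omega⟩, h⟩
  · rintro ⟨⟨h1, -⟩, h⟩
    exact ⟨⟨Nat.pos_of_dvd_of_pos h1 hN, (Nat.le_of_dvd hN h1).trans hK⟩, h⟩

theorem ite_forall_kFree_eq_sum {k r : ℕ} (hk : 1 ≤ k) (h : Fin r → ℕ) {n K : ℕ} (hn : 1 ≤ n)
    (hK : ∀ i, n + h i ≤ K) :
    (if ∀ i, KFree k (n + h i) then (1 : ℝ) else 0) =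
      ∑ d ∈ Fintype.piFinset (fun _ : Fin r => Finset.Icc 1 K),
        if ∀ i, d i ^ k ∣ n + h i then ∏ i, (ArithmeticFunction.moebius (d i) : ℝ) else 0 := by
  have h1 : (if ∀ i, KFree k (n + h i) then (1 : ℝ) else 0) =
      ∏ i, if KFree k (n + h i) then (1 : ℝ) else 0 := by
    rw [Finset.prod_ite_zero]; simp
  rw [h1, Finset.prod_congr rfl fun i _ =>
    (sum_Icc_moebius_pow_dvd (K := K) hk (by omega) (hK i)).symm, Finset.prod_univ_sum]
  refine Finset.sum_congr rfl fun d _ => ?_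
  rw [Finset.prod_ite_zero]
  simp

theorem countR_eq_sum {k r : ℕ} (hk : 1 ≤ k) (h : Fin r → ℕ) (t : ℝ) (q a K : ℕ)
    (hK : ∀ i, ⌊t⌋₊ + h i ≤ K) (y : ℝ) :
    (countR k r h t q a : ℝ) =
      (∑ d ∈ (Fintype.piFinset (fun _ : Fin r => Finset.Icc 1 K)).filter
          (fun d => ((Finset.univ.lcm d : ℕ) : ℝ) ≤ y),
        (∏ i, (ArithmeticFunction.moebius (d i) : ℝ)) * tupleCount k r h t q a d) +
      ∑ n ∈ (Finset.Icc 1 ⌊t⌋₊).filter (fun n => n % q = a % q),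
        ∑ d ∈ (Fintype.piFinset (fun _ : Fin r => Finset.Icc 1 K)).filter
            (fun d => ¬ ((Finset.univ.lcm d : ℕ) : ℝ) ≤ y),
          if ∀ i, d i ^ k ∣ n + h i then ∏ i, (ArithmeticFunction.moebius (d i) : ℝ) else 0 := by
  have h1 : (countR k r h t q a : ℝ) =
      ∑ n ∈ (Finset.Icc 1 ⌊t⌋₊).filter (fun n => n % q = a % q),
        if ∀ i, KFree k (n + h i) then (1 : ℝ) else 0 := by
    unfold countR
    rw [← Finset.sum_filter, Finset.filter_filter, Finset.sum_const, nsmul_eq_mul, mul_one]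
    simp only [and_comm]
  have h2 : ∀ d : Fin r → ℕ,
      (∏ i, (ArithmeticFunction.moebius (d i) : ℝ)) * tupleCount k r h t q a d =
      ∑ n ∈ (Finset.Icc 1 ⌊t⌋₊).filter (fun n => n % q = a % q),
        if ∀ i, d i ^ k ∣ n + h i then ∏ i, (ArithmeticFunction.moebius (d i) : ℝ) else 0 := by
    intro d
    unfold tupleCount
    rw [← Finset.sum_filter, Finset.filter_filter, Finset.sum_const, nsmul_eq_mul, mul_comm]
    simp only [and_comm]
  rw [h1, Finset.sum_congr rfl fun d _ => h2 d, Finset.sum_comm, ← Finset.sum_add_distrib]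
  refine Finset.sum_congr rfl fun n hn => ?_
  obtain ⟨hn1, -⟩ := Finset.mem_filter.1 hn
  rw [Finset.mem_Icc] at hn1
  rw [ite_forall_kFree_eq_sum hk h hn1.1 (K := K) fun i => by have := hK i; omega,
    Finset.sum_filter_add_sum_filter_not]

theorem abs_prod_moebius_le_one {r : ℕ} (d : Fin r → ℕ) :
    |∏ i, (ArithmeticFunction.moebius (d i) : ℝ)| ≤ 1 := by
  rw [Finset.abs_prod]
  refine Finset.prod_le_one (fun _ _ => abs_nonneg _) fun i _ => ?_
  exact_mod_cast ArithmeticFunction.abs_moebius_le_one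

theorem summable_tupleDensity {k r : ℕ} (hk : 2 ≤ k) (h : Fin r → ℕ) {q : ℕ} (hq : 1 ≤ q) (a : ℕ) :
    Summable (tupleDensity k r h q a) := by
  obtain ⟨C, hC, H⟩ := exists_sum_tuples_lcm_tail_le r k hk 1 one_pos le_rfl
  refine summable_of_sum_le (c := C * (1 / 2) ^ (1 - (k : ℝ)) * (1 / 2) ^ (1 : ℝ))
    (fun d => tupleDensity_nonneg k r h q a d) fun F => ?_
  refine (Finset.sum_le_sum fun d _ => tupleDensity_le k r h hq a d).trans ?_
  rw [← Finset.sum_filter]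
  refine le_trans (Finset.sum_le_sum fun d hd => ?_)
    (H (1 / 2) (by norm_num) (F.filter fun d => ∀ i, 1 ≤ d i) fun d hd => ?_)
  · have hd1 := one_le_lcm_of_forall_one_le (Finset.mem_filter.1 hd).2
    have : 0 < ((Finset.univ.lcm d) ^ k).divisors.card :=
      Finset.card_pos.2 ⟨1, by
        simp only [Nat.mem_divisors, one_dvd, true_and]
        positivity⟩
    gcongr
    exact_mod_cast this
  · refine ⟨(Finset.mem_filter.1 hd).2, ?_⟩
    have hd1 := one_le_lcm_of_forall_one_le (Finset.mem_filter.1 hd).2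
    have : (1 : ℝ) ≤ ((Finset.univ.lcm d : ℕ) : ℝ) := by exact_mod_cast hd1
    linarith

/-- The part of the density carried by tuples of least common multiple larger than `y`. -/
def tailDensity (k r : ℕ) (h : Fin r → ℕ) (y : ℝ) (q a : ℕ) : ℝ :=
  ∑' d : Fin r → ℕ,
    if ((Finset.univ.lcm d : ℕ) : ℝ) ≤ y then 0 else tupleDensity k r h q a d

theorem summable_tailDensity {k r : ℕ} (hk : 2 ≤ k) (h : Fin r → ℕ) (y : ℝ) {q : ℕ} (hq : 1 ≤ q)
    (a : ℕ) : Summable fun d : Fin r → ℕ =>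
      if ((Finset.univ.lcm d : ℕ) : ℝ) ≤ y then 0 else tupleDensity k r h q a d := by
  refine Summable.of_nonneg_of_le (fun d => ?_) (fun d => ?_) (summable_tupleDensity hk h hq a)
  · split_ifs
    · exact le_rfl
    · exact tupleDensity_nonneg _ _ _ _ _ _
  · split_ifs
    · exact tupleDensity_nonneg _ _ _ _ _ _
    · exact le_rfl

theorem abs_eta_sub_sum_le {k r : ℕ} (hk : 2 ≤ k) (h : Fin r → ℕ) {q : ℕ} (hq : 1 ≤ q) (a K : ℕ)
    (y : ℝ) (hK : ⌊y⌋₊ ≤ K) :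
    |eta k r h q a - ∑ d ∈ (Fintype.piFinset (fun _ : Fin r => Finset.Icc 1 K)).filter
          (fun d => ((Finset.univ.lcm d : ℕ) : ℝ) ≤ y),
        (∏ i, (ArithmeticFunction.moebius (d i) : ℝ)) * tupleDensity k r h q a d| ≤
      tailDensity k r h y q a := by
  set G : (Fin r → ℕ) → ℝ := fun d =>
    (∏ i, (ArithmeticFunction.moebius (d i) : ℝ)) * tupleDensity k r h q a d with hG
  have hGle : ∀ d, |G d| ≤ tupleDensity k r h q a d := fun d => by
    rw [hG, abs_mul, abs_of_nonneg (tupleDensity_nonneg k r h q a d)]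
    exact mul_le_of_le_one_left (tupleDensity_nonneg _ _ _ _ _ _) (abs_prod_moebius_le_one d)
  have hs := summable_tailDensity hk h y hq a
  set G2 : (Fin r → ℕ) → ℝ := fun d => if ((Finset.univ.lcm d : ℕ) : ℝ) ≤ y then 0 else G d with hG2
  set G1 : (Fin r → ℕ) → ℝ := fun d => if ((Finset.univ.lcm d : ℕ) : ℝ) ≤ y then G d else 0 with hG1
  have hG2le : ∀ d, ‖G2 d‖ ≤
      if ((Finset.univ.lcm d : ℕ) : ℝ) ≤ y then 0 else tupleDensity k r h q a d := fun d => by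
    rw [hG2]; dsimp only
    split_ifs
    · simp
    · exact hGle d
  have hs2 : Summable G2 := Summable.of_norm_bounded hs hG2le
  set U := (Fintype.piFinset (fun _ : Fin r => Finset.Icc 1 K)).filter
          (fun d => ((Finset.univ.lcm d : ℕ) : ℝ) ≤ y) with hU
  have hz : ∀ d ∉ U, G1 d = 0 := by
    intro d hd
    by_contra hne
    rw [hG1] at hne
    dsimp only at hne
    split_ifs at hne with hy
    · apply hd
      have hd1 : ∀ i, 1 ≤ d i := by
        by_contra hcon
        apply hne
        rw [hG]
        simp only [tupleDensity]
        rw [if_neg fun hc => hcon hc.1, mul_zero]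
      have hl := one_le_lcm_of_forall_one_le hd1
      refine Finset.mem_filter.2 ⟨Fintype.mem_piFinset.2 fun i => Finset.mem_Icc.2 ⟨hd1 i, ?_⟩, hy⟩
      exact (Nat.le_of_dvd hl (Finset.dvd_lcm (Finset.mem_univ i))).trans
        ((Nat.le_floor hy).trans hK)
    · exact hne rfl
  have h1 : HasSum G1 (∑ d ∈ U, G1 d) := hasSum_sum_of_ne_finset_zero hz
  have h1' : ∑ d ∈ U, G1 d = ∑ d ∈ U, G d :=
    Finset.sum_congr rfl fun d hd => by
      rw [hG1]; dsimp only; rw [if_pos (Finset.mem_filter.1 hd).2]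
  have h2 : eta k r h q a = ∑ d ∈ U, G d + ∑' d, G2 d := by
    rw [eta_eq_tsum, ← h1', ← (h1.add hs2.hasSum).tsum_eq]
    refine tsum_congr fun d => ?_
    simp only [hG1, hG2, hG]
    split_ifs <;> simp
  rw [h2, add_sub_cancel_left, ← Real.norm_eq_abs]
  exact tsum_of_norm_bounded hs.hasSum hG2le

/-- The `n ≤ t` for which some tuple of least common multiple larger than `y` satisfies the
divisibility conditions. -/
def largeTupleSet (k r : ℕ) (h : Fin r → ℕ) (t y : ℝ) : Finset ℕ :=
  (Finset.Icc 1 ⌊t⌋₊).filter fun n =>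
    ∃ d : Fin r → ℕ, (∀ i, 1 ≤ d i) ∧ (∀ i, d i ^ k ∣ n + h i) ∧ y < (Finset.univ.lcm d : ℕ)

theorem abs_sum_large_tuples_le {k r : ℕ} (hk : 1 ≤ k) (h : Fin r → ℕ) {t y B : ℝ}
    (hB : ∀ n ∈ Finset.Icc 1 ⌊t⌋₊, ∏ i, ((n + h i).divisors.card : ℝ) ≤ B) (K : ℕ) {n : ℕ}
    (hn : n ∈ Finset.Icc 1 ⌊t⌋₊) :
    |∑ d ∈ (Fintype.piFinset (fun _ : Fin r => Finset.Icc 1 K)).filter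
            (fun d => ¬ ((Finset.univ.lcm d : ℕ) : ℝ) ≤ y),
          if ∀ i, d i ^ k ∣ n + h i then ∏ i, (ArithmeticFunction.moebius (d i) : ℝ) else 0| ≤
      if n ∈ largeTupleSet k r h t y then B else 0 := by
  rw [← Finset.sum_filter, Finset.filter_filter]
  split_ifs with hM
  · refine (Finset.abs_sum_le_sum_abs _ _).trans
      ((Finset.sum_le_sum fun d _ => abs_prod_moebius_le_one d).trans ?_)
    rw [Finset.sum_const, nsmul_eq_mul, mul_one]
    refine le_trans ?_ (hB n hn)
    rw [← Nat.cast_prod, ← Fintype.card_piFinset]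
    refine Nat.cast_le.2 (Finset.card_le_card fun d hd => ?_)
    rw [Finset.mem_filter] at hd
    rw [Fintype.mem_piFinset]
    intro i
    rw [Finset.mem_Icc] at hn
    exact Nat.mem_divisors.2 ⟨(dvd_pow_self _ (by omega)).trans (hd.2.2 i), by omega⟩
  · rw [Finset.sum_eq_zero, abs_zero]
    intro d hd
    exfalso
    apply hM
    rw [Finset.mem_filter, Fintype.mem_piFinset] at hd
    exact Finset.mem_filter.2 ⟨hn, d, fun i => (Finset.mem_Icc.1 (hd.1 i)).1, hd.2.2,
      not_le.1 hd.2.1⟩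

theorem abs_Ex_le {k r : ℕ} (hk : 2 ≤ k) (h : Fin r → ℕ) {t y B A : ℝ} (ht : 0 ≤ t)
    (hB : ∀ n ∈ Finset.Icc 1 ⌊t⌋₊, ∏ i, ((n + h i).divisors.card : ℝ) ≤ B)
    (hA : ∀ F : Finset (Fin r → ℕ),
      (∀ d ∈ F, (∀ i, 1 ≤ d i) ∧ (Finset.univ.lcm d : ℕ) ≤ y) → (F.card : ℝ) ≤ A)
    {q : ℕ} (hq : 1 ≤ q) (a : ℕ) :
    |Ex k r h t q a| ≤ 2 * A +
      B * ((largeTupleSet k r h t y).filter (fun n => n % q = a % q)).card +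
      t * tailDensity k r h y q a := by
  set K := ⌊t⌋₊ + ∑ i, h i + ⌊y⌋₊ with hKdef
  have hK1 : ∀ i, ⌊t⌋₊ + h i ≤ K := fun i => by
    have := Finset.single_le_sum (f := h) (fun _ _ => Nat.zero_le _) (Finset.mem_univ i)
    omega
  have h1 := countR_eq_sum (by omega : 1 ≤ k) h t q a K hK1 y
  have h2 := abs_eta_sub_sum_le hk h hq a K y (by omega)
  set U := (Fintype.piFinset (fun _ : Fin r => Finset.Icc 1 K)).filter
          (fun d => ((Finset.univ.lcm d : ℕ) : ℝ) ≤ y) with hU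
  have hU1 : ∀ d ∈ U, (∀ i, 1 ≤ d i) ∧ ((Finset.univ.lcm d : ℕ) : ℝ) ≤ y := by
    intro d hd
    rw [hU, Finset.mem_filter, Fintype.mem_piFinset] at hd
    exact ⟨fun i => (Finset.mem_Icc.1 (hd.1 i)).1, hd.2⟩
  set S2 := ∑ n ∈ (Finset.Icc 1 ⌊t⌋₊).filter (fun n => n % q = a % q),
        ∑ d ∈ (Fintype.piFinset (fun _ : Fin r => Finset.Icc 1 K)).filter
            (fun d => ¬ ((Finset.univ.lcm d : ℕ) : ℝ) ≤ y),
          if ∀ i, d i ^ k ∣ n + h i then ∏ i, (ArithmeticFunction.moebius (d i) : ℝ) else 0 with hS2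
  set D := ∑ d ∈ U, (∏ i, (ArithmeticFunction.moebius (d i) : ℝ)) * tupleDensity k r h q a d with hD
  have h3 : Ex k r h t q a = (∑ d ∈ U, (∏ i, (ArithmeticFunction.moebius (d i) : ℝ)) *
      (tupleCount k r h t q a d - tupleDensity k r h q a d * t)) + S2 -
      t * (eta k r h q a - D) := by
    unfold Ex
    rw [h1]
    simp only [mul_sub, Finset.sum_sub_distrib, ← mul_assoc, ← Finset.sum_mul]
    rw [← hD]
    ring
  have b1 : |∑ d ∈ U, (∏ i, (ArithmeticFunction.moebius (d i) : ℝ)) *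
      (tupleCount k r h t q a d - tupleDensity k r h q a d * t)| ≤ 2 * A := by
    refine (Finset.abs_sum_le_sum_abs _ _).trans ?_
    calc _ ≤ ∑ d ∈ U, (2 : ℝ) := Finset.sum_le_sum fun d hd => by
          rw [abs_mul]
          calc _ ≤ 1 * (2 : ℝ) := mul_le_mul (abs_prod_moebius_le_one d)
                (abs_tupleCount_sub_le ht hq (hU1 d hd).1) (abs_nonneg _) zero_le_one
            _ = 2 := one_mul _
      _ = 2 * U.card := by rw [Finset.sum_const, nsmul_eq_mul, mul_comm]
      _ ≤ 2 * A := by gcongr; exact hA U hU1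
  have b2 : |S2| ≤ B * ((largeTupleSet k r h t y).filter (fun n => n % q = a % q)).card := by
    refine (Finset.abs_sum_le_sum_abs _ _).trans ((Finset.sum_le_sum fun n hn =>
      abs_sum_large_tuples_le (by omega) h hB K (Finset.mem_filter.1 hn).1).trans ?_)
    rw [← Finset.sum_filter, Finset.sum_const, nsmul_eq_mul, mul_comm]
    refine le_of_eq ?_
    congr 3
    ext n
    simp only [Finset.mem_filter, largeTupleSet]
    tauto
  have b3 : |t * (eta k r h q a - D)| ≤ t * tailDensity k r h y q a := by
    rw [abs_mul, abs_of_nonneg ht]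
    gcongr
  rw [h3]
  refine (abs_sub _ _).trans ?_
  refine (add_le_add (abs_add_le _ _) le_rfl).trans ?_
  linarith

theorem sum_card_filter_mod_sq_le (M : Finset ℕ) (T Γ : ℕ) (hM : M ⊆ Finset.Icc 1 T) (D : ℝ)
    (hD : ∀ n ∈ Finset.Icc 1 T, (n.divisors.card : ℝ) ≤ D) :
    ∑ q ∈ Finset.Icc 1 Γ, ∑ a ∈ Finset.Icc 1 q,
        ((M.filter (fun n => n % q = a % q)).card : ℝ) ^ 2 ≤
      Γ * M.card + D * (M.card : ℝ) ^ 2 := by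
  have h1 : ∀ q ∈ Finset.Icc 1 Γ, ∑ a ∈ Finset.Icc 1 q,
      ((M.filter (fun n => n % q = a % q)).card : ℝ) ^ 2 ≤
        ∑ n ∈ M, ∑ m ∈ M, if n % q = m % q then (1 : ℝ) else 0 := by
    intro q hq
    rw [Finset.mem_Icc] at hq
    have e1 : ∀ a, ((M.filter (fun n => n % q = a % q)).card : ℝ) ^ 2 =
        ∑ n ∈ M, ∑ m ∈ M, if n % q = a % q ∧ m % q = a % q then (1 : ℝ) else 0 := by
      intro a
      rw [Finset.card_filter, sq, Nat.cast_sum, Finset.sum_mul_sum]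
      refine Finset.sum_congr rfl fun n _ => Finset.sum_congr rfl fun m _ => ?_
      by_cases c1 : n % q = a % q <;> by_cases c2 : m % q = a % q <;> simp [c1, c2]
    rw [Finset.sum_congr rfl fun a _ => e1 a, Finset.sum_comm]
    refine Finset.sum_le_sum fun n _ => ?_
    rw [Finset.sum_comm]
    refine Finset.sum_le_sum fun m _ => ?_
    split_ifs with hnm
    · rw [← Finset.sum_filter, Finset.sum_const, nsmul_eq_mul, mul_one]
      have := card_filter_modEq_of_dvd (by omega) (dvd_refl q) n
      rw [Nat.div_self (by omega)] at this
      rw [← Nat.cast_one (R := ℝ), ← this]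
      refine Nat.cast_le.2 (Finset.card_le_card fun a ha => ?_)
      rw [Finset.mem_filter, Finset.mem_Icc] at ha
      exact Finset.mem_filter.2 ⟨Finset.mem_Ioc.2 (by omega), ha.2.1.symm⟩
    · refine le_of_eq (Finset.sum_eq_zero fun a _ => if_neg fun hc => hnm ?_)
      rw [hc.1, hc.2]
  refine (Finset.sum_le_sum h1).trans ?_
  rw [Finset.sum_comm]
  have h2 : ∀ n ∈ M, ∑ q ∈ Finset.Icc 1 Γ, ∑ m ∈ M, (if n % q = m % q then (1 : ℝ) else 0) ≤
      Γ + D * M.card := by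
    intro n hn
    rw [Finset.sum_comm]
    have h3 : ∀ m ∈ M, ∑ q ∈ Finset.Icc 1 Γ, (if n % q = m % q then (1 : ℝ) else 0) ≤
        (if m = n then (Γ : ℝ) else 0) + D := by
      intro m hm
      have hn' := Finset.mem_Icc.1 (hM hn)
      have hm' := Finset.mem_Icc.1 (hM hm)
      have hD0 : 0 ≤ D := (Nat.cast_nonneg _).trans (hD n (hM hn))
      rw [← Finset.sum_filter, Finset.sum_const, nsmul_eq_mul, mul_one]
      split_ifs with hmn
      · have : ((Finset.Icc 1 Γ).filter fun q => n % q = m % q).card ≤ Γ := by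
          refine (Finset.card_filter_le _ _).trans ?_
          simp
        have : (((Finset.Icc 1 Γ).filter fun q => n % q = m % q).card : ℝ) ≤ Γ := by
          exact_mod_cast this
        linarith
      · rw [zero_add]
        refine le_trans ?_ (hD ((n : ℤ) - m).natAbs (Finset.mem_Icc.2 (by omega)))
        refine Nat.cast_le.2 (Finset.card_le_card fun q hq => ?_)
        have hq2 : n ≡ m [MOD q] := (Finset.mem_filter.1 hq).2
        rw [Nat.mem_divisors]
        refine ⟨?_, by omega⟩
        rw [← Int.natCast_dvd]
        exact (Nat.modEq_iff_dvd.1 hq2.symm)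
    refine (Finset.sum_le_sum h3).trans (le_of_eq ?_)
    rw [Finset.sum_add_distrib, Finset.sum_ite_eq' M n, if_pos hn, Finset.sum_const, nsmul_eq_mul]
    ring
  refine (Finset.sum_le_sum h2).trans (le_of_eq ?_)
  rw [Finset.sum_const, nsmul_eq_mul]
  ring

theorem sum_tailDensity_sq_le {k r : ℕ} (hk : 2 ≤ k) (h : Fin r → ℕ) {y T : ℝ} (hT0 : 0 ≤ T)
    (hT : ∀ F : Finset (Fin r → ℕ),
      (∀ d ∈ F, (∀ i, 1 ≤ d i) ∧ y < (Finset.univ.lcm d : ℕ)) →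
        ∑ d ∈ F, (((Finset.univ.lcm d) ^ k).divisors.card : ℝ) /
          ((Finset.univ.lcm d : ℕ) : ℝ) ^ k ≤ T) (Γ : ℕ) :
    ∑ q ∈ Finset.Icc 1 Γ, ∑ a ∈ Finset.Icc 1 q, tailDensity k r h y q a ^ 2 ≤
      (1 + Real.log Γ) * T ^ 2 := by
  have hlim : Filter.Tendsto (fun F : Finset (Fin r → ℕ) =>
      ∑ q ∈ Finset.Icc 1 Γ, ∑ a ∈ Finset.Icc 1 q, (∑ d ∈ F,
        if ((Finset.univ.lcm d : ℕ) : ℝ) ≤ y then 0 else tupleDensity k r h q a d) ^ 2)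
      Filter.atTop
      (nhds (∑ q ∈ Finset.Icc 1 Γ, ∑ a ∈ Finset.Icc 1 q, tailDensity k r h y q a ^ 2)) := by
    refine tendsto_finsetSum _ fun q hq => tendsto_finsetSum _ fun a _ => ?_
    exact (summable_tailDensity hk h y (Finset.mem_Icc.1 hq).1 a).hasSum.pow 2
  refine le_of_tendsto' hlim fun F => ?_
  set F' := F.filter fun d => (∀ i, 1 ≤ d i) ∧ y < (Finset.univ.lcm d : ℕ) with hF'
  have hF'1 : ∀ d ∈ F', (∀ i, 1 ≤ d i) ∧ y < (Finset.univ.lcm d : ℕ) := fun d hd =>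
    (Finset.mem_filter.1 hd).2
  set m : (Fin r → ℕ) → ℝ := fun d => ((Finset.univ.lcm d : ℕ) : ℝ) ^ k with hm
  have hm0 : ∀ d ∈ F', 0 < m d := fun d hd => by
    have := one_le_lcm_of_forall_one_le (hF'1 d hd).1
    simp only [hm]
    positivity
  have e1 : ∀ q a, (∑ d ∈ F,
      if ((Finset.univ.lcm d : ℕ) : ℝ) ≤ y then 0 else tupleDensity k r h q a d) =
        ∑ d ∈ F', tupleDensity k r h q a d := by
    intro q a
    rw [hF', Finset.sum_filter]
    refine Finset.sum_congr rfl fun d _ => ?_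
    by_cases c1 : ((Finset.univ.lcm d : ℕ) : ℝ) ≤ y
    · rw [if_pos c1, if_neg fun hc => not_lt.2 c1 hc.2]
    · rw [if_neg c1]
      by_cases c2 : ∀ i, 1 ≤ d i
      · rw [if_pos ⟨c2, not_le.1 c1⟩]
      · rw [if_neg fun hc => c2 hc.1, tupleDensity, if_neg fun hc => c2 hc.1]
  have hcs : ∀ q a, (∑ d ∈ F', tupleDensity k r h q a d) ^ 2 ≤
      (∑ d ∈ F', 1 / m d) * ∑ d ∈ F', m d * tupleDensity k r h q a d ^ 2 := by
    intro q a
    refine Finset.sum_sq_le_sum_mul_sum_of_sq_le_mul _ (fun d hd => ?_) (fun d hd => ?_)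
      fun d hd => ?_
    · have := hm0 d hd; positivity
    · have := hm0 d hd; positivity
    · have := hm0 d hd
      apply le_of_eq
      field_simp
  have hw : ∑ d ∈ F', 1 / m d ≤ T := by
    refine le_trans (Finset.sum_le_sum fun d hd => ?_) (hT F' hF'1)
    have h0 := hm0 d hd
    have : 0 < ((Finset.univ.lcm d) ^ k).divisors.card := Finset.card_pos.2 ⟨1, by
        have := one_le_lcm_of_forall_one_le (hF'1 d hd).1
        simp only [Nat.mem_divisors, one_dvd, true_and]
        positivity⟩
    refine div_le_div_of_nonneg_right ?_ h0.le
    exact_mod_cast this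
  have hw0 : 0 ≤ ∑ d ∈ F', 1 / m d := Finset.sum_nonneg fun d hd => by
    have := hm0 d hd; positivity
  have hlog : 0 ≤ 1 + Real.log Γ := by
    have := Real.log_natCast_nonneg Γ
    linarith
  calc _ ≤ ∑ q ∈ Finset.Icc 1 Γ, ∑ a ∈ Finset.Icc 1 q,
        ((∑ d ∈ F', 1 / m d) * ∑ d ∈ F', m d * tupleDensity k r h q a d ^ 2) :=
        Finset.sum_le_sum fun q _ => Finset.sum_le_sum fun a _ => by
          rw [e1]; exact hcs q a
    _ = (∑ d ∈ F', 1 / m d) * ∑ d ∈ F', m d * ∑ q ∈ Finset.Icc 1 Γ,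
        ∑ a ∈ Finset.Icc 1 q, tupleDensity k r h q a d ^ 2 := by
        simp only [← Finset.mul_sum]
        congr 1
        simp only [Finset.mul_sum]
        rw [Finset.sum_comm (s := F')]
        exact Finset.sum_congr rfl fun q _ => Finset.sum_comm
    _ ≤ (∑ d ∈ F', 1 / m d) * ∑ d ∈ F', (1 + Real.log Γ) *
        ((((Finset.univ.lcm d) ^ k).divisors.card : ℝ) / m d) := by
        gcongr (∑ d ∈ F', 1 / m d) * ?_
        refine Finset.sum_le_sum fun d hd => ?_
        have h0 := hm0 d hd
        have hl := one_le_lcm_of_forall_one_le (hF'1 d hd).1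
        calc _ ≤ m d * ∑ q ∈ Finset.Icc 1 Γ,
              (Nat.gcd q ((Finset.univ.lcm d) ^ k) : ℝ) / q * (1 / m d ^ 2) := by
              gcongr m d * ?_
              refine Finset.sum_le_sum fun q hq => ?_
              refine (sum_tupleDensity_sq_le k r h (Finset.mem_Icc.1 hq).1
                (hF'1 d hd).1).trans (le_of_eq ?_)
              rw [div_mul_div_comm, mul_one]
          _ = (1 / m d) * ∑ q ∈ Finset.Icc 1 Γ,
              (Nat.gcd q ((Finset.univ.lcm d) ^ k) : ℝ) / q := by
              rw [← Finset.sum_mul]; field_simp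
          _ ≤ (1 / m d) * ((((Finset.univ.lcm d) ^ k).divisors.card : ℝ) *
              (1 + Real.log Γ)) := by
              gcongr
              exact sum_gcd_div_le Γ _ (by positivity)
          _ = _ := by ring
    _ = (∑ d ∈ F', 1 / m d) * ((1 + Real.log Γ) *
        ∑ d ∈ F', (((Finset.univ.lcm d) ^ k).divisors.card : ℝ) / m d) := by
        simp only [← Finset.mul_sum]
    _ ≤ T * ((1 + Real.log Γ) * T) := by
        have h0 : 0 ≤ ∑ d ∈ F', (((Finset.univ.lcm d) ^ k).divisors.card : ℝ) / m d :=
          Finset.sum_nonneg fun d hd => div_nonneg (Nat.cast_nonneg _) (hm0 d hd).le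
        exact mul_le_mul hw (mul_le_mul_of_nonneg_left (hT F' hF'1) hlog)
          (mul_nonneg hlog h0) hT0
    _ = _ := by ring

theorem exists_tuple_lcm_le {k r : ℕ} (h : Fin r → ℕ) {n : ℕ} {y Z : ℝ} (hZ1 : 1 ≤ Z)
    (hy0 : 0 < y) (hyZ : y ^ 2 ≤ Z) (hp : ∀ (p : ℕ) i, p ^ k ∣ n + h i → (p : ℝ) ≤ Z)
    (hn : ∃ d : Fin r → ℕ, (∀ i, 1 ≤ d i) ∧ (∀ i, d i ^ k ∣ n + h i) ∧
      y < (Finset.univ.lcm d : ℕ)) :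
    ∃ d : Fin r → ℕ, (∀ i, 1 ≤ d i) ∧ (∀ i, d i ^ k ∣ n + h i) ∧
      y < (Finset.univ.lcm d : ℕ) ∧ (Finset.univ.lcm d : ℕ) ≤ Z := by
  have hex : ∃ P, ∃ d : Fin r → ℕ, ((∀ i, 1 ≤ d i) ∧ (∀ i, d i ^ k ∣ n + h i) ∧
      y < (Finset.univ.lcm d : ℕ)) ∧ ∏ i, d i = P := by
    obtain ⟨d, hd⟩ := hn
    exact ⟨_, d, hd, rfl⟩
  obtain ⟨d, ⟨hd1, hd2, hd3⟩, hdP⟩ := Nat.find_spec hex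
  have hmin : ∀ d' : Fin r → ℕ, (∀ i, 1 ≤ d' i) → (∀ i, d' i ^ k ∣ n + h i) →
      y < (Finset.univ.lcm d' : ℕ) → ∏ i, d i ≤ ∏ i, d' i := fun d' a b c => by
    rw [hdP]
    exact Nat.find_min' hex ⟨d', ⟨a, b, c⟩, rfl⟩
  refine ⟨d, hd1, hd2, hd3, ?_⟩
  by_cases hall : ∀ i, d i = 1
  · have : Finset.univ.lcm d = 1 := by
      refine Nat.dvd_one.1 (Finset.lcm_dvd fun i _ => ?_)
      rw [hall i]
    rw [this]
    exact_mod_cast hZ1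
  push Not at hall
  obtain ⟨i, hi⟩ := hall
  obtain ⟨p, hpp, c, hc⟩ := Nat.exists_prime_and_dvd hi
  by_cases hpy : (p : ℝ) ≤ y
  · set d' := Function.update d i c with hd'
    have hc1 : 1 ≤ c := by
      rcases Nat.eq_zero_or_pos c with rfl | hc0
      · have := hd1 i; omega
      · exact hc0
    have hd'1 : ∀ j, 1 ≤ d' j := by
      intro j
      rcases eq_or_ne j i with rfl | hj
      · simpa [hd'] using hc1
      · simpa [hd', hj] using hd1 j
    have hd'd : ∀ j, d' j ∣ d j ∧ d j ∣ p * d' j := by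
      intro j
      rcases eq_or_ne j i with rfl | hj
      · simp [hd', hc]
      · simp [hd', hj]
    have hlt : ∏ j, d' j < ∏ j, d j := by
      refine Finset.prod_lt_prod (fun j _ => hd'1 j)
        (fun j _ => Nat.le_of_dvd (hd1 j) (hd'd j).1) ⟨i, Finset.mem_univ _, ?_⟩
      rw [hc]
      simp only [hd', Function.update_self]
      exact lt_mul_of_one_lt_left hc1 hpp.one_lt
    have hd'y : ((Finset.univ.lcm d' : ℕ) : ℝ) ≤ y := by
      by_contra hcon
      refine absurd (hmin d' hd'1 (fun j => ?_) (not_le.1 hcon)) (not_le.2 hlt)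
      exact (pow_dvd_pow_of_dvd (hd'd j).1 k).trans (hd2 j)
    have hdvd : Finset.univ.lcm d ∣ p * Finset.univ.lcm d' :=
      Finset.lcm_dvd fun j _ => (hd'd j).2.trans
        (Nat.mul_dvd_mul_left _ (Finset.dvd_lcm (Finset.mem_univ j)))
    have hle := Nat.le_of_dvd
      (Nat.mul_pos hpp.pos (one_le_lcm_of_forall_one_le hd'1)) hdvd
    calc ((Finset.univ.lcm d : ℕ) : ℝ) ≤ (p : ℝ) * (Finset.univ.lcm d' : ℕ) := by exact_mod_cast hle
      _ ≤ y * y := by gcongr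
      _ = y ^ 2 := (sq y).symm
      _ ≤ Z := hyZ
  · have hpd : p ^ k ∣ n + h i := (pow_dvd_pow_of_dvd ⟨c, hc⟩ k).trans (hd2 i)
    set d' : Fin r → ℕ := Function.update (fun _ => 1) i p with hd'
    have hprod : ∏ j, d' j = p := by
      rw [hd', Finset.prod_update_of_mem (Finset.mem_univ i)]
      simp
    have hle : ∏ j, d j ≤ p := by
      rw [← hprod]
      refine hmin d' (fun j => ?_) (fun j => ?_) ?_
      · rcases eq_or_ne j i with rfl | hj
        · simpa [hd'] using hpp.one_lt.le
        · simp [hd', hj]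
      · rcases eq_or_ne j i with rfl | hj
        · simpa [hd'] using hpd
        · simp [hd', hj]
      · have h1 : p ∣ Finset.univ.lcm d' := by
          have := Finset.dvd_lcm (f := d') (Finset.mem_univ i)
          simpa [hd'] using this
        have h2 : Finset.univ.lcm d' ≠ 0 := by
          rw [Ne, Finset.lcm_eq_zero_iff]
          rintro ⟨j, -, hj⟩
          rcases eq_or_ne j i with rfl | hji
          · simp [hd', hpp.ne_zero] at hj
          · simp [hd', hji] at hj
        exact (not_le.1 hpy).trans_le (by exact_mod_cast Nat.le_of_dvd (by omega) h1)
    have h1 : Finset.univ.lcm d ∣ ∏ j, d j :=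
      Finset.lcm_dvd fun j hj => Finset.dvd_prod_of_mem _ hj
    have h2 := Nat.le_of_dvd (Finset.prod_pos fun j _ => hd1 j) h1
    exact (Nat.cast_le.2 (h2.trans hle)).trans (hp p i hpd)

theorem card_largeTupleSet_le {k r : ℕ} (h : Fin r → ℕ) {t y Z T A : ℝ}
    (ht : 0 ≤ t) (hZ1 : 1 ≤ Z) (hy0 : 0 < y) (hyZ : y ^ 2 ≤ Z)
    (hp : ∀ n ∈ Finset.Icc 1 ⌊t⌋₊, ∀ (p : ℕ) i, p ^ k ∣ n + h i → (p : ℝ) ≤ Z)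
    (hT : ∀ F : Finset (Fin r → ℕ),
      (∀ d ∈ F, (∀ i, 1 ≤ d i) ∧ y < (Finset.univ.lcm d : ℕ)) →
        ∑ d ∈ F, (((Finset.univ.lcm d) ^ k).divisors.card : ℝ) /
          ((Finset.univ.lcm d : ℕ) : ℝ) ^ k ≤ T)
    (hA : ∀ F : Finset (Fin r → ℕ),
      (∀ d ∈ F, (∀ i, 1 ≤ d i) ∧ (Finset.univ.lcm d : ℕ) ≤ Z) → (F.card : ℝ) ≤ A) :
    ((largeTupleSet k r h t y).card : ℝ) ≤ t * T + 2 * A := by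
  set F := (Fintype.piFinset (fun _ : Fin r => Finset.Icc 1 ⌊Z⌋₊)).filter
    (fun d => y < (Finset.univ.lcm d : ℕ) ∧ ((Finset.univ.lcm d : ℕ) : ℝ) ≤ Z) with hF
  have hF1 : ∀ d ∈ F, (∀ i, 1 ≤ d i) ∧ y < (Finset.univ.lcm d : ℕ) ∧
      ((Finset.univ.lcm d : ℕ) : ℝ) ≤ Z := by
    intro d hd
    rw [hF, Finset.mem_filter, Fintype.mem_piFinset] at hd
    exact ⟨fun i => (Finset.mem_Icc.1 (hd.1 i)).1, hd.2⟩
  have hsub : largeTupleSet k r h t y ⊆ F.biUnion fun d =>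
      (Finset.Icc 1 ⌊t⌋₊).filter fun n => (∀ i, d i ^ k ∣ n + h i) ∧ n % 1 = 0 % 1 := by
    intro n hn
    obtain ⟨hn1, hn2⟩ := Finset.mem_filter.1 hn
    obtain ⟨d, hd1, hd2, hd3, hd4⟩ := exists_tuple_lcm_le h hZ1 hy0 hyZ (hp n hn1) hn2
    refine Finset.mem_biUnion.2 ⟨d, ?_, Finset.mem_filter.2 ⟨hn1, hd2, by simp [Nat.mod_one]⟩⟩
    refine Finset.mem_filter.2 ⟨Fintype.mem_piFinset.2 fun i =>
      Finset.mem_Icc.2 ⟨hd1 i, ?_⟩, hd3, hd4⟩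
    exact (Nat.le_of_dvd (one_le_lcm_of_forall_one_le hd1)
      (Finset.dvd_lcm (Finset.mem_univ i))).trans (Nat.le_floor hd4)
  have h1 : (largeTupleSet k r h t y).card ≤ ∑ d ∈ F, tupleCount k r h t 1 0 d :=
    (Finset.card_le_card hsub).trans Finset.card_biUnion_le
  have h2 : ∀ d ∈ F, (tupleCount k r h t 1 0 d : ℝ) ≤
      t * ((((Finset.univ.lcm d) ^ k).divisors.card : ℝ) /
          ((Finset.univ.lcm d : ℕ) : ℝ) ^ k) + 2 := by
    intro d hd
    have hd1 := (hF1 d hd).1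
    have a1 := (abs_le.1 (abs_tupleCount_sub_le (k := k) (h := h) ht (le_refl 1) (a := 0) hd1)).2
    have a2 := tupleDensity_le k r h (le_refl 1) 0 d
    rw [if_pos hd1] at a2
    have hl := one_le_lcm_of_forall_one_le hd1
    have a3 : (1 : ℝ) ≤ (((Finset.univ.lcm d) ^ k).divisors.card : ℝ) := by
      have : 0 < ((Finset.univ.lcm d) ^ k).divisors.card := Finset.card_pos.2 ⟨1, by
        simp only [Nat.mem_divisors, one_dvd, true_and]
        positivity⟩
      exact_mod_cast this
    have a4 : 1 / ((Finset.univ.lcm d : ℕ) : ℝ) ^ k ≤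
        (((Finset.univ.lcm d) ^ k).divisors.card : ℝ) / ((Finset.univ.lcm d : ℕ) : ℝ) ^ k := by
      gcongr
    have := mul_le_mul_of_nonneg_right (a2.trans a4) ht
    linarith
  calc ((largeTupleSet k r h t y).card : ℝ) ≤ ∑ d ∈ F, (tupleCount k r h t 1 0 d : ℝ) := by
        exact_mod_cast h1
    _ ≤ _ := Finset.sum_le_sum h2
    _ = t * (∑ d ∈ F, (((Finset.univ.lcm d) ^ k).divisors.card : ℝ) /
          ((Finset.univ.lcm d : ℕ) : ℝ) ^ k) + 2 * F.card := by
        rw [Finset.sum_add_distrib, ← Finset.mul_sum, Finset.sum_const, nsmul_eq_mul]; ring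
    _ ≤ t * T + 2 * A := by
        gcongr
        · exact hT F fun d hd => ⟨(hF1 d hd).1, (hF1 d hd).2.1⟩
        · exact hA F fun d hd => ⟨(hF1 d hd).1, (hF1 d hd).2.2⟩

theorem sum_sq_Ex_le {k r : ℕ} (hk : 2 ≤ k) (h : Fin r → ℕ) {t y A B D T : ℝ} (ht : 0 ≤ t)
    (hT0 : 0 ≤ T)
    (hB : ∀ n ∈ Finset.Icc 1 ⌊t⌋₊, ∏ i, ((n + h i).divisors.card : ℝ) ≤ B)
    (hD : ∀ n ∈ Finset.Icc 1 ⌊t⌋₊, (n.divisors.card : ℝ) ≤ D)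
    (hA : ∀ F : Finset (Fin r → ℕ),
      (∀ d ∈ F, (∀ i, 1 ≤ d i) ∧ (Finset.univ.lcm d : ℕ) ≤ y) → (F.card : ℝ) ≤ A)
    (hT : ∀ F : Finset (Fin r → ℕ),
      (∀ d ∈ F, (∀ i, 1 ≤ d i) ∧ y < (Finset.univ.lcm d : ℕ)) →
        ∑ d ∈ F, (((Finset.univ.lcm d) ^ k).divisors.card : ℝ) /
          ((Finset.univ.lcm d : ℕ) : ℝ) ^ k ≤ T) (Γ : ℕ) :
    ∑ q ∈ Finset.Icc 1 Γ, ∑ a ∈ Finset.Icc 1 q, |Ex k r h t q a| ^ 2 ≤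
      3 * ((Γ : ℝ) ^ 2 * (2 * A) ^ 2 +
        B ^ 2 * (Γ * (largeTupleSet k r h t y).card +
          D * ((largeTupleSet k r h t y).card : ℝ) ^ 2) +
        t ^ 2 * ((1 + Real.log Γ) * T ^ 2)) := by
  have h1 : ∀ q ∈ Finset.Icc 1 Γ, ∀ a ∈ Finset.Icc 1 q, |Ex k r h t q a| ^ 2 ≤
      3 * ((2 * A) ^ 2 +
        B ^ 2 * (((largeTupleSet k r h t y).filter (fun n => n % q = a % q)).card : ℝ) ^ 2 +
        t ^ 2 * tailDensity k r h y q a ^ 2) := by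
    intro q hq a _
    have h2 := abs_Ex_le hk h ht hB hA (Finset.mem_Icc.1 hq).1 a
    refine (pow_le_pow_left₀ (abs_nonneg _) h2 2).trans ?_
    nlinarith [sq_nonneg (2 * A -
        B * (((largeTupleSet k r h t y).filter (fun n => n % q = a % q)).card : ℝ)),
      sq_nonneg (2 * A - t * tailDensity k r h y q a),
      sq_nonneg (B * (((largeTupleSet k r h t y).filter (fun n => n % q = a % q)).card : ℝ) -
        t * tailDensity k r h y q a)]
  have h3 : ∑ q ∈ Finset.Icc 1 Γ, ∑ a ∈ Finset.Icc 1 q, (2 * A) ^ 2 ≤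
      (Γ : ℝ) ^ 2 * (2 * A) ^ 2 := by
    have : ∀ q ∈ Finset.Icc 1 Γ, ∑ a ∈ Finset.Icc 1 q, (2 * A) ^ 2 ≤ Γ * (2 * A) ^ 2 := by
      intro q hq
      rw [Finset.sum_const, Nat.card_Icc, nsmul_eq_mul, Nat.add_sub_cancel]
      have : (q : ℝ) ≤ Γ := by exact_mod_cast (Finset.mem_Icc.1 hq).2
      gcongr
    refine (Finset.sum_le_sum this).trans (le_of_eq ?_)
    rw [Finset.sum_const, Nat.card_Icc, nsmul_eq_mul, Nat.add_sub_cancel]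
    ring
  have h4 := sum_card_filter_mod_sq_le (largeTupleSet k r h t y) ⌊t⌋₊ Γ
    (Finset.filter_subset _ _) D hD
  have h5 := sum_tailDensity_sq_le hk h hT0 hT Γ
  calc _ ≤ ∑ q ∈ Finset.Icc 1 Γ, ∑ a ∈ Finset.Icc 1 q, 3 * ((2 * A) ^ 2 +
        B ^ 2 * (((largeTupleSet k r h t y).filter (fun n => n % q = a % q)).card : ℝ) ^ 2 +
        t ^ 2 * tailDensity k r h y q a ^ 2) :=
        Finset.sum_le_sum fun q hq => Finset.sum_le_sum fun a ha => h1 q hq a ha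
    _ = 3 * (∑ q ∈ Finset.Icc 1 Γ, ∑ a ∈ Finset.Icc 1 q, (2 * A) ^ 2 +
        B ^ 2 * ∑ q ∈ Finset.Icc 1 Γ, ∑ a ∈ Finset.Icc 1 q,
          (((largeTupleSet k r h t y).filter (fun n => n % q = a % q)).card : ℝ) ^ 2 +
        t ^ 2 * ∑ q ∈ Finset.Icc 1 Γ, ∑ a ∈ Finset.Icc 1 q, tailDensity k r h y q a ^ 2) := by
        simp only [← Finset.mul_sum, Finset.sum_add_distrib]
    _ ≤ _ := by gcongr

theorem exists_sieve_level {k : ℕ} (hk : 2 ≤ k) {t γ : ℝ} (ht : 1 ≤ t) (hγ : 1 ≤ γ) :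
    ∃ y : ℝ, 0 < y ∧ y ≤ t ∧ y ^ 2 ≤ t ^ Delta k ∧
      γ ^ 2 * y ^ 2 ≤ γ ^ (2 - 2 * theta k) * t ^ (2 * theta k) ∧
      t * y ^ (1 - (k : ℝ)) ≤ γ ^ (1 - theta k) * t ^ theta k + t ^ Delta k := by
  have ht0 : 0 < t := by linarith
  have hγ0 : 0 < γ := by linarith
  have hk2 : (2 : ℝ) ≤ k := by exact_mod_cast hk
  set e : ℝ := 1 / (k + 1) with he
  have hy1 : 0 < (t / γ) ^ theta k := Real.rpow_pos_of_pos (div_pos ht0 hγ0) _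
  have hy2 : 0 < t ^ e := Real.rpow_pos_of_pos ht0 _
  have hy : 0 < min ((t / γ) ^ theta k) (t ^ e) := lt_min hy1 hy2
  refine ⟨min ((t / γ) ^ theta k) (t ^ e), hy, ?_, ?_, ?_, ?_⟩
  · refine (min_le_right _ _).trans ?_
    conv_rhs => rw [← Real.rpow_one t]
    refine Real.rpow_le_rpow_of_exponent_le ht ?_
    rw [he, div_le_one (by positivity)]
    linarith
  · calc _ ≤ (t ^ e) ^ 2 := pow_le_pow_left₀ hy.le (min_le_right _ _) 2
      _ = t ^ Delta k := by
        rw [← Real.rpow_natCast, ← Real.rpow_mul ht0.le]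
        congr 1
        rw [he, Delta]; push_cast; ring
  · calc _ ≤ γ ^ 2 * ((t / γ) ^ theta k) ^ 2 := by
          gcongr
          exact min_le_left _ _
      _ = _ := by
        rw [Real.rpow_sub hγ0, Real.div_rpow ht0.le hγ0.le, mul_comm 2 (theta k),
          Real.rpow_mul hγ0.le, Real.rpow_mul ht0.le, Real.rpow_two, Real.rpow_two, Real.rpow_two]
        field_simp
  · have c1 : t * ((t / γ) ^ theta k) ^ (1 - (k : ℝ)) = γ ^ (1 - theta k) * t ^ theta k := by
      rw [← Real.rpow_mul (div_pos ht0 hγ0).le, Real.div_rpow ht0.le hγ0.le]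
      have : theta k * (1 - (k : ℝ)) = theta k - 1 := by
        rw [theta]; field_simp
      rw [this, Real.rpow_sub ht0, Real.rpow_sub hγ0, Real.rpow_sub hγ0, Real.rpow_one,
        Real.rpow_one]
      have := Real.rpow_pos_of_pos hγ0 (theta k)
      field_simp
    have c2 : t * (t ^ e) ^ (1 - (k : ℝ)) = t ^ Delta k := by
      rw [← Real.rpow_mul ht0.le]
      conv_lhs => rw [← Real.rpow_one t, ← Real.rpow_mul ht0.le, ← Real.rpow_add ht0]
      congr 1
      rw [he, Delta]; field_simp; ring
    have p1 : 0 ≤ γ ^ (1 - theta k) * t ^ theta k := by positivity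
    have p2 : 0 ≤ t ^ Delta k := by positivity
    rcases min_choice ((t / γ) ^ theta k) (t ^ e) with h1 | h1
    · rw [h1, c1]; linarith
    · rw [h1, c2]; linarith

theorem rpow_mul_combination_le {k : ℕ} (hk : 2 ≤ k) {t γ c s N u : ℝ} (ht : 1 ≤ t) (hγ : 1 ≤ γ)
    (hc : 1 ≤ c) (hs : 1 ≤ s) (hN0 : 0 ≤ N) (hNt : N ≤ t) (hu0 : 0 ≤ u)
    (hu : u ≤ γ ^ (1 - theta k) * t ^ theta k + t ^ Delta k)
    (hN : N ≤ 2 * (c * s) * (u + t ^ Delta k)) :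
    u ^ 2 ≤ 2 * (γ ^ (2 - 2 * theta k) * t ^ (2 * theta k) + t ^ (2 * Delta k)
        + γ * t ^ Delta k) ∧
    N ^ 2 ≤ 24 * (c * s) ^ 2 * (γ ^ (2 - 2 * theta k) * t ^ (2 * theta k) + t ^ (2 * Delta k)
        + γ * t ^ Delta k) ∧
    γ * N ≤ 4 * (c * s) * (γ ^ (2 - 2 * theta k) * t ^ (2 * theta k) + t ^ (2 * Delta k)
        + γ * t ^ Delta k) := by
  have ht0 : 0 < t := by linarith
  have hγ0 : 0 < γ := by linarith
  have hk2 : (2 : ℝ) ≤ k := by exact_mod_cast hk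
  have hth0 : 0 ≤ theta k := by rw [theta]; positivity
  have hth : theta k ≤ 1 / 2 := by
    rw [theta]; exact one_div_le_one_div_of_le (by norm_num) hk2
  have eX : γ ^ (2 - 2 * theta k) * t ^ (2 * theta k) = (γ ^ (1 - theta k) * t ^ theta k) ^ 2 := by
    rw [mul_pow, ← Real.rpow_natCast, ← Real.rpow_natCast, ← Real.rpow_mul ht0.le,
      ← Real.rpow_mul hγ0.le]
    push_cast
    congr 2 <;> ring
  have eY : t ^ (2 * Delta k) = (t ^ Delta k) ^ 2 := by
    rw [← Real.rpow_natCast, ← Real.rpow_mul ht0.le]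
    push_cast
    congr 1; ring
  have hcs : 1 ≤ c * s := one_le_mul_of_one_le_of_one_le hc hs
  have hγN : γ * N ≤ 4 * (c * s) * (γ ^ (2 - 2 * theta k) * t ^ (2 * theta k) + t ^ (2 * Delta k)
        + γ * t ^ Delta k) := by
    have hX0 : 0 ≤ γ ^ (2 - 2 * theta k) * t ^ (2 * theta k) := by positivity
    have hY0 : 0 ≤ t ^ (2 * Delta k) := by positivity
    have hW0 : 0 ≤ γ * t ^ Delta k := by positivity
    rcases le_total γ t with hγt | hγt
    · have h1 : γ * (γ ^ (1 - theta k) * t ^ theta k) ≤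
          γ ^ (2 - 2 * theta k) * t ^ (2 * theta k) := by
        have e1 : γ * (γ ^ (1 - theta k) * t ^ theta k) =
            γ ^ (2 - 2 * theta k) * (t ^ theta k * γ ^ theta k) := by
          have : γ ^ (2 - 2 * theta k) * γ ^ theta k = γ * γ ^ (1 - theta k) := by
            conv_rhs => rw [← Real.rpow_one γ, ← Real.rpow_mul hγ0.le]
            rw [← Real.rpow_add hγ0, ← Real.rpow_add hγ0]
            congr 1; ring
          linear_combination (-t ^ theta k) * this
        rw [e1, two_mul (theta k), Real.rpow_add ht0]
        gcongr
      calc γ * N ≤ γ * (2 * (c * s) * ((γ ^ (1 - theta k) * t ^ theta k + t ^ Delta k) +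
            t ^ Delta k)) := by
            gcongr
            exact hN.trans (by gcongr)
        _ = 2 * (c * s) * (γ * (γ ^ (1 - theta k) * t ^ theta k) + 2 * (γ * t ^ Delta k)) := by
            ring
        _ ≤ 2 * (c * s) * (2 * (γ ^ (2 - 2 * theta k) * t ^ (2 * theta k) + t ^ (2 * Delta k)
            + γ * t ^ Delta k)) := by
            gcongr
            linarith
        _ = _ := by ring
    · have h1 : γ * t ≤ γ ^ (2 - 2 * theta k) * t ^ (2 * theta k) := by
        have e1 : γ ^ (2 - 2 * theta k) = γ * γ ^ (1 - 2 * theta k) := by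
          conv_rhs => rw [← Real.rpow_one γ, ← Real.rpow_mul hγ0.le, ← Real.rpow_add hγ0]
          congr 1; ring
        have e2 : t = t ^ (1 - 2 * theta k) * t ^ (2 * theta k) := by
          rw [← Real.rpow_add ht0]
          ring_nf
          rw [Real.rpow_one]
        rw [e1, mul_assoc]
        nth_rewrite 1 [e2]
        have : 0 ≤ 1 - 2 * theta k := by linarith
        gcongr
      calc γ * N ≤ γ * t := by gcongr
        _ ≤ 1 * (γ ^ (2 - 2 * theta k) * t ^ (2 * theta k) + t ^ (2 * Delta k)
            + γ * t ^ Delta k) := by linarith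
        _ ≤ _ := by gcongr; linarith
  refine ⟨?_, ?_, hγN⟩
  · have h1 := pow_le_pow_left₀ hu0 hu 2
    have hW0 : 0 ≤ γ * t ^ Delta k := by positivity
    rw [eX, eY]
    nlinarith [sq_nonneg (γ ^ (1 - theta k) * t ^ theta k - t ^ Delta k)]
  · have hW0 : 0 ≤ γ * t ^ Delta k := by positivity
    have h1 := pow_le_pow_left₀ hN0 (hN.trans (by gcongr :
      _ ≤ 2 * (c * s) * ((γ ^ (1 - theta k) * t ^ theta k + t ^ Delta k) + t ^ Delta k))) 2
    refine h1.trans ?_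
    rw [eX, eY, mul_pow, mul_pow]
    have : 24 * (c * s) ^ 2 * ((γ ^ (1 - theta k) * t ^ theta k) ^ 2 + (t ^ Delta k) ^ 2
        + γ * t ^ Delta k) = 2 ^ 2 * (c * s) ^ 2 *
        (6 * ((γ ^ (1 - theta k) * t ^ theta k) ^ 2 + (t ^ Delta k) ^ 2
        + γ * t ^ Delta k)) := by ring
    rw [this]
    gcongr
    nlinarith [sq_nonneg (γ ^ (1 - theta k) * t ^ theta k - t ^ Delta k)]

theorem rpow_theta_add_le {k : ℕ} (hk : 2 ≤ k) {H t : ℝ} (hH : 0 ≤ H) (ht : 1 ≤ t) {m p : ℕ}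
    (hm : 0 < m) (hmt : (m : ℝ) ≤ t + H) (hp : p ^ k ∣ m) : (p : ℝ) ≤ (1 + H) * t ^ Delta k := by
  have hk2 : (2 : ℝ) ≤ k := by exact_mod_cast hk
  have hle : ((p : ℝ)) ^ k ≤ (1 + H) * t := by
    have : ((p ^ k : ℕ) : ℝ) ≤ m := by exact_mod_cast Nat.le_of_dvd hm hp
    push_cast at this
    nlinarith
  have ht0 : 0 < t := by linarith
  have hth : theta k ≤ 1 := by
    rw [theta, div_le_one (by positivity)]; linarith
  have hth0 : 0 ≤ theta k := by rw [theta]; positivity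
  have hthD : theta k ≤ Delta k := by
    rw [theta, Delta, div_le_div_iff₀ (by positivity) (by positivity)]; linarith
  calc (p : ℝ) = ((p : ℝ) ^ k) ^ theta k := by
        rw [theta, one_div, Real.pow_rpow_inv_natCast (by positivity) (by omega)]
    _ ≤ ((1 + H) * t) ^ theta k := by gcongr
    _ = (1 + H) ^ theta k * t ^ theta k := Real.mul_rpow (by linarith) ht0.le
    _ ≤ (1 + H) * t ^ Delta k := by
        gcongr
        conv_rhs => rw [← Real.rpow_one (1 + H)]
        exact Real.rpow_le_rpow_of_exponent_le (by linarith) hth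

set_option maxHeartbeats 1000000 in
theorem exists_sum_sq_Ex_le {k r : ℕ} (hk : 2 ≤ k) (hr : 1 ≤ r) (h : Fin r → ℕ) {ε : ℝ}
    (hε : 0 < ε) :
    ∃ C : ℝ, 0 ≤ C ∧ ∀ t γ : ℝ, 1 ≤ t → 1 ≤ γ →
      ∑ q ∈ Finset.Icc 1 ⌊γ⌋₊, ∑ ν ∈ Finset.Icc 1 q, |Ex k r h t q ν| ^ 2
          ≤ C * (t * γ) ^ ε *
            (γ ^ (2 - 2 * theta k) * t ^ (2 * theta k) + t ^ (2 * Delta k)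
              + γ * t ^ (Delta k)) := by
  set δ : ℝ := min (ε / 5) 1 with hδ
  have hδ0 : 0 < δ := lt_min (by positivity) one_pos
  have hδ1 : δ ≤ 1 := min_le_right _ _
  have hδε : δ * 5 ≤ ε := by have := min_le_left (ε / 5) 1; linarith
  have hr0 : (0 : ℝ) < r := by exact_mod_cast hr
  have hr1 : (1 : ℝ) ≤ r := by exact_mod_cast hr
  obtain ⟨C1, hC1, hτ⟩ := exists_card_divisors_le_mul_rpow (δ / r) (by positivity)
  obtain ⟨C2, hC2, hcard⟩ := exists_card_tuples_lcm_le r δ hδ0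
  obtain ⟨C3, hC3, htail⟩ := exists_sum_tuples_lcm_tail_le r k hk δ hδ0 hδ1
  set H : ℝ := ∑ i, (h i : ℝ) with hH
  have hH0 : 0 ≤ H := Finset.sum_nonneg fun i _ => Nat.cast_nonneg _
  have hhH : ∀ i, (h i : ℝ) ≤ H := fun i =>
    Finset.single_le_sum (f := fun i => (h i : ℝ)) (fun i _ => Nat.cast_nonneg _)
      (Finset.mem_univ i)
  obtain ⟨c, hc1, hcB, hcD, hcA, hcT, hcZ, hcL⟩ : ∃ c : ℝ, 1 ≤ c ∧ C1 ^ r * (1 + H) ≤ c ∧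
      C1 ≤ c ∧ C2 ≤ c ∧ C3 ≤ c ∧ C2 * (1 + H) ^ 2 ≤ c ∧ 1 + 1 / δ ≤ c := by
    have : 0 < 1 / δ := by positivity
    have : 0 ≤ C1 ^ r * (1 + H) := by positivity
    have : 0 ≤ C2 * (1 + H) ^ 2 := by positivity
    refine ⟨C1 ^ r * (1 + H) + C1 + C2 + C3 + C2 * (1 + H) ^ 2 + (1 + 1 / δ), ?_, ?_, ?_, ?_, ?_,
      ?_, ?_⟩ <;> linarith
  refine ⟨102 * c ^ 5, by positivity, fun t γ ht hγ => ?_⟩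
  obtain ⟨y, hy0, hyt, hyΔ, hγy, hty⟩ := exists_sieve_level hk ht hγ
  have ht0 : 0 < t := by linarith
  have hγ0 : 0 < γ := by linarith
  set s : ℝ := (t * γ) ^ δ with hs
  have htγ : 1 ≤ t * γ := one_le_mul_of_one_le_of_one_le ht hγ
  have hs1 : 1 ≤ s := Real.one_le_rpow htγ hδ0.le
  have htδ : t ^ δ ≤ s := Real.rpow_le_rpow ht0.le (le_mul_of_one_le_right ht0.le hγ) hδ0.le
  have hγδ : γ ^ δ ≤ s := Real.rpow_le_rpow hγ0.le (le_mul_of_one_le_left hγ0.le ht) hδ0.le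
  have hyδ : y ^ δ ≤ s := (Real.rpow_le_rpow hy0.le hyt hδ0.le).trans htδ
  have hHδ : (1 + H) ^ δ ≤ 1 + H := by
    conv_rhs => rw [← Real.rpow_one (1 + H)]
    exact Real.rpow_le_rpow_of_exponent_le (by linarith) hδ1
  have hΔ0 : 0 ≤ Delta k := by rw [Delta]; positivity
  have hΔ1 : Delta k ≤ 1 := by
    have hk2 : (2 : ℝ) ≤ k := by exact_mod_cast hk
    rw [Delta, div_le_one (by positivity)]; linarith
  have htΔ1 : 1 ≤ t ^ Delta k := Real.one_le_rpow ht hΔ0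
  have htΔt : t ^ Delta k ≤ t := by
    conv_rhs => rw [← Real.rpow_one t]
    exact Real.rpow_le_rpow_of_exponent_le ht hΔ1
  have hle_t : ∀ n ∈ Finset.Icc 1 ⌊t⌋₊, 1 ≤ n ∧ (n : ℝ) ≤ t := fun n hn =>
    ⟨(Finset.mem_Icc.1 hn).1, (Nat.le_floor_iff ht0.le).1 (Finset.mem_Icc.1 hn).2⟩
  have hB : ∀ n ∈ Finset.Icc 1 ⌊t⌋₊, ∏ i, ((n + h i).divisors.card : ℝ) ≤ c * s := by
    intro n hn
    obtain ⟨hn1, hnt⟩ := hle_t n hn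
    have h1 : ∀ i ∈ Finset.univ, ((n + h i).divisors.card : ℝ) ≤
        C1 * ((1 + H) * t) ^ (δ / r) := by
      intro i _
      refine (hτ (n + h i) (by omega)).trans ?_
      have : ((n + h i : ℕ) : ℝ) ≤ (1 + H) * t := by
        push_cast
        nlinarith [hhH i]
      gcongr
    calc _ ≤ ∏ _i : Fin r, C1 * ((1 + H) * t) ^ (δ / r) :=
          Finset.prod_le_prod (fun i _ => Nat.cast_nonneg _) h1
      _ = C1 ^ r * ((1 + H) ^ δ * t ^ δ) := by
          rw [Finset.prod_const, Finset.card_univ, Fintype.card_fin, mul_pow,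
            ← Real.rpow_natCast (((1 + H) * t) ^ (δ / r)), ← Real.rpow_mul (by positivity),
            div_mul_cancel₀ _ hr0.ne', Real.mul_rpow (by positivity) ht0.le]
      _ ≤ C1 ^ r * ((1 + H) * s) := by gcongr
      _ = (C1 ^ r * (1 + H)) * s := by ring
      _ ≤ c * s := by gcongr
  have hD : ∀ n ∈ Finset.Icc 1 ⌊t⌋₊, (n.divisors.card : ℝ) ≤ c * s := by
    intro n hn
    obtain ⟨hn1, hnt⟩ := hle_t n hn
    calc _ ≤ C1 * (n : ℝ) ^ (δ / r) := hτ n hn1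
      _ ≤ C1 * t ^ (δ / r) := by gcongr
      _ ≤ C1 * t ^ δ := by
          gcongr
          exact div_le_self hδ0.le hr1
      _ ≤ c * s := by gcongr
  have hA : ∀ F : Finset (Fin r → ℕ),
      (∀ d ∈ F, (∀ i, 1 ≤ d i) ∧ (Finset.univ.lcm d : ℕ) ≤ y) → (F.card : ℝ) ≤ c * s * y :=
    fun F hF => by
      calc (F.card : ℝ) ≤ C2 * y * y ^ δ := hcard y hy0 F hF
        _ ≤ c * y * s := by gcongr
        _ = _ := by ring
  have hT : ∀ F : Finset (Fin r → ℕ),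
      (∀ d ∈ F, (∀ i, 1 ≤ d i) ∧ y < (Finset.univ.lcm d : ℕ)) →
        ∑ d ∈ F, (((Finset.univ.lcm d) ^ k).divisors.card : ℝ) /
          ((Finset.univ.lcm d : ℕ) : ℝ) ^ k ≤ c * s * y ^ (1 - (k : ℝ)) :=
    fun F hF => by
      calc _ ≤ C3 * y ^ (1 - (k : ℝ)) * y ^ δ := htail y hy0 F hF
        _ ≤ c * y ^ (1 - (k : ℝ)) * s := by gcongr
        _ = _ := by ring
  have hZ1 : 1 ≤ (1 + H) * t ^ Delta k := one_le_mul_of_one_le_of_one_le (by linarith) htΔ1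
  have hAZ : ∀ F : Finset (Fin r → ℕ),
      (∀ d ∈ F, (∀ i, 1 ≤ d i) ∧ (Finset.univ.lcm d : ℕ) ≤ (1 + H) * t ^ Delta k) →
        (F.card : ℝ) ≤ c * s * t ^ Delta k :=
    fun F hF => by
      calc (F.card : ℝ) ≤ C2 * ((1 + H) * t ^ Delta k) * ((1 + H) * t ^ Delta k) ^ δ :=
            hcard _ (by positivity) F hF
        _ ≤ C2 * ((1 + H) * t ^ Delta k) * ((1 + H) * t) ^ δ := by gcongr
        _ = C2 * ((1 + H) * t ^ Delta k) * ((1 + H) ^ δ * t ^ δ) := by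
            rw [Real.mul_rpow (by positivity) ht0.le]
        _ ≤ C2 * ((1 + H) * t ^ Delta k) * ((1 + H) * s) := by gcongr
        _ = (C2 * (1 + H) ^ 2) * s * t ^ Delta k := by ring
        _ ≤ c * s * t ^ Delta k := by gcongr
  have hL : 1 + Real.log (⌊γ⌋₊ : ℝ) ≤ c * s := by
    have h1 : Real.log (⌊γ⌋₊ : ℝ) ≤ Real.log γ := by
      refine Real.log_le_log ?_ (Nat.floor_le hγ0.le)
      exact_mod_cast Nat.floor_pos.2 hγ
    have h2 := Real.log_le_rpow_div hγ0.le hδ0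
    have h3 : 1 ≤ γ ^ δ := Real.one_le_rpow hγ hδ0.le
    calc _ ≤ γ ^ δ + γ ^ δ / δ := by linarith
      _ = (1 + 1 / δ) * γ ^ δ := by ring
      _ ≤ c * s := by gcongr
  have hmain := sum_sq_Ex_le hk h ht0.le (y := y) (by positivity) hB hD hA hT ⌊γ⌋₊
  have hN := card_largeTupleSet_le (k := k) h ht0.le hZ1 hy0
    (hyΔ.trans (le_mul_of_one_le_left (by positivity) (by linarith)))
    (fun n hn p i hp => rpow_theta_add_le hk hH0 ht (m := n + h i)
      (by have := (hle_t n hn).1; omega)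
      (by push_cast; exact add_le_add (hle_t n hn).2 (hhH i)) hp) hT hAZ
  have hNt : ((largeTupleSet k r h t y).card : ℝ) ≤ t := by
    refine le_trans ?_ (Nat.floor_le ht0.le)
    have : (largeTupleSet k r h t y).card ≤ (Finset.Icc 1 ⌊t⌋₊).card :=
      Finset.card_filter_le _ _
    rw [Nat.card_Icc, Nat.add_sub_cancel] at this
    exact_mod_cast this
  set N : ℝ := ((largeTupleSet k r h t y).card : ℝ) with hNdef
  have hN0 : 0 ≤ N := Nat.cast_nonneg _
  have hΓ : (⌊γ⌋₊ : ℝ) ≤ γ := Nat.floor_le hγ0.le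
  have hcs : 1 ≤ c * s := one_le_mul_of_one_le_of_one_le hc1 hs1
  obtain ⟨hu2, hN2, hγN⟩ := rpow_mul_combination_le hk ht hγ hc1 hs1 hN0 hNt
    (u := t * y ^ (1 - (k : ℝ))) (by positivity) hty (by
      have : 0 ≤ c * s * (t * y ^ (1 - (k : ℝ))) := by positivity
      nlinarith)
  set R : ℝ := γ ^ (2 - 2 * theta k) * t ^ (2 * theta k) + t ^ (2 * Delta k)
    + γ * t ^ Delta k with hR
  have hR0 : 0 ≤ R := by positivity
  have hγyR : γ ^ 2 * y ^ 2 ≤ R := by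
    have h1 : 0 ≤ t ^ (2 * Delta k) := by positivity
    have h2 : 0 ≤ γ * t ^ Delta k := by positivity
    linarith
  have hs5 : s ^ 5 ≤ (t * γ) ^ ε := by
    rw [hs, ← Real.rpow_natCast, ← Real.rpow_mul (by positivity)]
    exact Real.rpow_le_rpow_of_exponent_le htγ (by push_cast; exact hδε)
  have hpow : ∀ j ≤ 5, (c * s) ^ j ≤ (c * s) ^ 5 := fun j hj => pow_le_pow_right₀ hcs hj
  calc _ ≤ _ := hmain
    _ ≤ 3 * (γ ^ 2 * (2 * (c * s * y)) ^ 2 + (c * s) ^ 2 * (γ * N + c * s * N ^ 2) +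
        t ^ 2 * (c * s * (c * s * y ^ (1 - (k : ℝ))) ^ 2)) := by gcongr
    _ = 3 * (4 * (c * s) ^ 2 * (γ ^ 2 * y ^ 2) + (c * s) ^ 2 * (γ * N) + (c * s) ^ 3 * N ^ 2 +
        (c * s) ^ 3 * (t * y ^ (1 - (k : ℝ))) ^ 2) := by ring
    _ ≤ 3 * (4 * (c * s) ^ 2 * R + (c * s) ^ 2 * (4 * (c * s) * R) +
        (c * s) ^ 3 * (24 * (c * s) ^ 2 * R) + (c * s) ^ 3 * (2 * R)) := by gcongr
    _ = 3 * (4 * ((c * s) ^ 2 * R) + 6 * ((c * s) ^ 3 * R) + 24 * ((c * s) ^ 5 * R)) := by ring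
    _ ≤ 3 * (4 * ((c * s) ^ 5 * R) + 6 * ((c * s) ^ 5 * R) + 24 * ((c * s) ^ 5 * R)) := by
        gcongr 3 * (4 * (?_ * R) + 6 * (?_ * R) + _)
        · exact hpow 2 (by norm_num)
        · exact hpow 3 (by norm_num)
    _ = 102 * c ^ 5 * s ^ 5 * R := by ring
    _ ≤ _ := by gcongr

theorem sum_rpow_neg_mul_le_dyadic {a : ℕ → ℝ} (ha : ∀ q, 0 ≤ a q) {α : ℝ} (hα : 0 ≤ α) (Γ : ℕ) :
    ∑ q ∈ Finset.Icc 1 Γ, (q : ℝ) ^ (-α) * a q ≤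
      ∑ j ∈ Finset.range (Nat.log 2 Γ + 1),
        ((2 : ℝ) ^ j) ^ (-α) * ∑ q ∈ Finset.Icc 1 (2 ^ (j + 1)), a q := by
  have hmaps : ∀ q ∈ Finset.Icc 1 Γ, Nat.log 2 q ∈ Finset.range (Nat.log 2 Γ + 1) := fun q hq =>
    Finset.mem_range.2 (Nat.lt_succ_of_le (Nat.log_mono_right (Finset.mem_Icc.1 hq).2))
  rw [← Finset.sum_fiberwise_of_maps_to hmaps]
  refine Finset.sum_le_sum fun j _ => ?_
  rw [Finset.mul_sum]
  have hnn : ∀ q ∈ Finset.Icc 1 (2 ^ (j + 1)), 0 ≤ ((2 : ℝ) ^ j) ^ (-α) * a q := fun q _ =>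
    mul_nonneg (by positivity) (ha q)
  refine (Finset.sum_le_sum fun q hq => ?_).trans
    (Finset.sum_le_sum_of_subset_of_nonneg (fun q hq => ?_) fun q hq _ => hnn q hq)
  · obtain ⟨hq1, hq2⟩ := Finset.mem_filter.1 hq
    have hq0 : q ≠ 0 := by have := (Finset.mem_Icc.1 hq1).1; omega
    have : ((2 : ℝ) ^ j) ≤ q := by
      have := Nat.pow_log_le_self 2 hq0
      rw [hq2] at this
      exact_mod_cast this
    exact mul_le_mul_of_nonneg_right
      (Real.rpow_le_rpow_of_nonpos (by positivity) this (by linarith)) (ha q)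
  · obtain ⟨hq1, hq2⟩ := Finset.mem_filter.1 hq
    refine Finset.mem_Icc.2 ⟨(Finset.mem_Icc.1 hq1).1, ?_⟩
    rw [← hq2]
    exact (Nat.lt_pow_succ_log_self one_lt_two q).le

theorem rpow_le_rpow_of_one_le {x γ b c : ℝ} (hx : 1 ≤ x) (hxγ : x ≤ γ) (hbc : b ≤ c)
    (hc : 0 ≤ c) : x ^ b ≤ γ ^ c :=
  (Real.rpow_le_rpow_of_exponent_le hx hbc).trans (Real.rpow_le_rpow (by linarith) hxγ hc)

theorem natLog_floor_add_one_le {γ δ : ℝ} (hγ : 1 ≤ γ) (hδ : 0 < δ) :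
    ((Nat.log 2 ⌊γ⌋₊ + 1 : ℕ) : ℝ) ≤ (1 + 2 / δ) * γ ^ δ := by
  have hγ0 : 0 < γ := by linarith
  have hpow : (2 : ℝ) ^ Nat.log 2 ⌊γ⌋₊ ≤ γ := by
    refine le_trans ?_ (Nat.floor_le hγ0.le)
    exact_mod_cast Nat.pow_log_le_self 2 (Nat.floor_pos.2 hγ).ne'
  have h1 := Real.log_le_log (by positivity) hpow
  rw [Real.log_pow] at h1
  have h2 := Real.log_le_rpow_div hγ0.le hδ
  have h3 : 1 ≤ γ ^ δ := Real.one_le_rpow hγ hδ.le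
  have h4 := Real.log_two_gt_d9
  have h5 : (Nat.log 2 ⌊γ⌋₊ : ℝ) ≤ 2 * (γ ^ δ / δ) := by
    have : (0 : ℝ) ≤ Nat.log 2 ⌊γ⌋₊ := Nat.cast_nonneg _
    nlinarith
  push_cast
  calc _ ≤ 2 * (γ ^ δ / δ) + γ ^ δ := by linarith
    _ = _ := by ring

theorem sum_rpow_neg_mul_le {a : ℕ → ℝ} (ha : ∀ q, 0 ≤ a q) {α e b c γ K P Q S : ℝ} (hα : 0 ≤ α)
    (hγ : 1 ≤ γ) (hK : 0 ≤ K) (hP : 0 ≤ P) (hQ : 0 ≤ Q) (hS : 0 ≤ S) (he : e ≤ 2)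
    (hb : e - α ≤ b) (hb0 : 0 ≤ b) (hc : 1 - α ≤ c) (hc0 : 0 ≤ c)
    (hsum : ∀ x : ℝ, 1 ≤ x → x ≤ 2 * γ →
      ∑ q ∈ Finset.Icc 1 ⌊x⌋₊, a q ≤ K * (x ^ e * P + Q + x * S)) :
    ∑ q ∈ Finset.Icc 1 ⌊γ⌋₊, (q : ℝ) ^ (-α) * a q ≤
      4 * K * ((Nat.log 2 ⌊γ⌋₊ + 1 : ℕ) : ℝ) * (γ ^ b * P + Q + γ ^ c * S) := by
  have hγ0 : 0 < γ := by linarith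
  refine (sum_rpow_neg_mul_le_dyadic ha hα _).trans ?_
  have hterm : ∀ j ∈ Finset.range (Nat.log 2 ⌊γ⌋₊ + 1),
      ((2 : ℝ) ^ j) ^ (-α) * ∑ q ∈ Finset.Icc 1 (2 ^ (j + 1)), a q ≤
        4 * K * (γ ^ b * P + Q + γ ^ c * S) := by
    intro j hj
    have hxγ : (2 : ℝ) ^ j ≤ γ := by
      refine le_trans ?_ (Nat.floor_le hγ0.le)
      have := Nat.pow_le_of_le_log (b := 2) (Nat.floor_pos.2 hγ).ne'
        (Nat.lt_succ_iff.1 (Finset.mem_range.1 hj))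
      exact_mod_cast this
    have hx1 : (1 : ℝ) ≤ 2 ^ j := one_le_pow₀ one_le_two
    have hfl : ⌊2 * (2 : ℝ) ^ j⌋₊ = 2 ^ (j + 1) := by
      rw [← pow_succ']
      exact_mod_cast Nat.floor_natCast (R := ℝ) (2 ^ (j + 1))
    have h1 := hsum (2 * 2 ^ j) (by linarith) (by linarith)
    rw [hfl] at h1
    set x : ℝ := 2 ^ j with hx
    have hx0 : 0 < x := by linarith
    have k1 : x ^ (-α) * (2 * x) ^ e ≤ 4 * γ ^ b := by
      have : (2 : ℝ) ^ e ≤ 4 := by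
        calc (2 : ℝ) ^ e ≤ 2 ^ (2 : ℝ) := Real.rpow_le_rpow_of_exponent_le one_le_two he
          _ = 4 := by norm_num
      have h2 := rpow_le_rpow_of_one_le hx1 hxγ hb hb0
      calc x ^ (-α) * (2 * x) ^ e = 2 ^ e * x ^ (e - α) := by
            rw [Real.mul_rpow (by norm_num) hx0.le, Real.rpow_sub hx0, Real.rpow_neg hx0.le]
            ring
        _ ≤ 4 * γ ^ b := by gcongr
    have k2 : x ^ (-α) ≤ 1 := by
      have := rpow_le_rpow_of_one_le hx1 hxγ (b := -α) (c := 0) (by linarith) le_rfl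
      rwa [Real.rpow_zero] at this
    have k3 : x ^ (-α) * (2 * x) ≤ 4 * γ ^ c := by
      have h2 := rpow_le_rpow_of_one_le hx1 hxγ hc hc0
      have h3 : x ^ (1 - α) = x * x ^ (-α) := by
        rw [sub_eq_add_neg, Real.rpow_add hx0, Real.rpow_one]
      have h4 : 0 ≤ x ^ (1 - α) := by positivity
      nlinarith
    calc _ ≤ x ^ (-α) * (K * ((2 * x) ^ e * P + Q + 2 * x * S)) := by gcongr
      _ = K * ((x ^ (-α) * (2 * x) ^ e) * P + x ^ (-α) * Q + (x ^ (-α) * (2 * x)) * S) := by ring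
      _ ≤ K * (4 * γ ^ b * P + 4 * Q + 4 * γ ^ c * S) := by
          gcongr
          linarith
      _ = _ := by ring
  refine (Finset.sum_le_sum hterm).trans (le_of_eq ?_)
  rw [Finset.sum_const, Finset.card_range, nsmul_eq_mul]
  ring

theorem exists_sum_rpow_neg_mul_sq_Ex_le {k r : ℕ} (hk : 2 ≤ k) (hr : 1 ≤ r) (h : Fin r → ℕ)
    {ε : ℝ} (hε : 0 < ε) {α b c : ℝ} (hα : 0 ≤ α) (hb : 2 - 2 * theta k - α ≤ b) (hb0 : 0 ≤ b)
    (hc : 1 - α ≤ c) (hc0 : 0 ≤ c) :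
    ∃ C : ℝ, 0 ≤ C ∧ ∀ t γ : ℝ, 1 ≤ t → 1 ≤ γ →
      ∑ q ∈ Finset.Icc 1 ⌊γ⌋₊, (q : ℝ) ^ (-α) * ∑ ν ∈ Finset.Icc 1 q, |Ex k r h t q ν| ^ 2
          ≤ C * (t * γ) ^ ε *
            (γ ^ b * t ^ (2 * theta k) + t ^ (2 * Delta k) + γ ^ c * t ^ (Delta k)) := by
  obtain ⟨C, hC0, hC⟩ := exists_sum_sq_Ex_le hk hr h (half_pos hε)
  refine ⟨4 * (C * 2 ^ (ε / 2)) * (1 + 2 / (ε / 2)), by positivity, fun t γ ht hγ => ?_⟩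
  have ht0 : 0 < t := by linarith
  have hγ0 : 0 < γ := by linarith
  have hth0 : 0 ≤ theta k := by rw [theta]; positivity
  have h1 := sum_rpow_neg_mul_le (a := fun q => ∑ ν ∈ Finset.Icc 1 q, |Ex k r h t q ν| ^ 2)
    (fun q => Finset.sum_nonneg fun ν _ => by positivity) hα hγ
    (K := C * (2 ^ (ε / 2) * (t * γ) ^ (ε / 2))) (P := t ^ (2 * theta k)) (Q := t ^ (2 * Delta k))
    (S := t ^ Delta k) (by positivity) (by positivity) (by positivity) (by positivity)
    (e := 2 - 2 * theta k) (by linarith) hb hb0 hc hc0 (fun x hx1 hx2 => by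
      refine (hC t x ht hx1).trans ?_
      rw [← Real.mul_rpow (by norm_num) (by positivity)]
      have : t * x ≤ 2 * (t * γ) := by nlinarith
      gcongr)
  refine h1.trans ?_
  have h2 := natLog_floor_add_one_le hγ (half_pos hε)
  have h3 : γ ^ (ε / 2) ≤ (t * γ) ^ (ε / 2) :=
    Real.rpow_le_rpow hγ0.le (le_mul_of_one_le_left hγ0.le ht) (half_pos hε).le
  have h4 : (t * γ) ^ (ε / 2) * (t * γ) ^ (ε / 2) = (t * γ) ^ ε := by
    rw [← Real.rpow_add (by positivity), add_halves]
  calc _ ≤ 4 * (C * (2 ^ (ε / 2) * (t * γ) ^ (ε / 2))) * ((1 + 2 / (ε / 2)) * (t * γ) ^ (ε / 2)) *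
        (γ ^ b * t ^ (2 * theta k) + t ^ (2 * Delta k) + γ ^ c * t ^ (Delta k)) := by
        gcongr
        exact h2.trans (by gcongr)
    _ = 4 * (C * 2 ^ (ε / 2)) * (1 + 2 / (ε / 2)) * ((t * γ) ^ (ε / 2) * (t * γ) ^ (ε / 2)) *
        (γ ^ b * t ^ (2 * theta k) + t ^ (2 * Delta k) + γ ^ c * t ^ (Delta k)) := by ring
    _ = _ := by rw [h4]

/-- four averaged bounds for the error terms `E_t(q,ν)`. -/
theorem stmt_5 (k r : ℕ) (hk : 2 ≤ k) (hr : 1 ≤ r) (h : Fin r → ℕ) (hh : StrictMono h)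
    (ε : ℝ) (hε : 0 < ε) :
    ∃ C : ℝ, ∀ t γ : ℝ, 1 ≤ t → 1 ≤ γ →
      ((∑ q ∈ Finset.Icc 1 ⌊γ⌋₊, ∑ ν ∈ Finset.Icc 1 q, |Ex k r h t q ν| ^ 2)
          ≤ C * (t * γ) ^ ε *
            (γ ^ (2 - 2 * theta k) * t ^ (2 * theta k) + t ^ (2 * Delta k)
              + γ * t ^ (Delta k))) ∧
      ((∑ q ∈ Finset.Icc 1 ⌊γ⌋₊, (1 / (q : ℝ)) * ∑ ν ∈ Finset.Icc 1 q, |Ex k r h t q ν| ^ 2)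
          ≤ C * (t * γ) ^ ε *
            (γ ^ (1 - 2 * theta k) * t ^ (2 * theta k) + t ^ (2 * Delta k))) ∧
      ((∑ q ∈ Finset.Icc 1 ⌊γ⌋₊,
            (q : ℝ) ^ (-(1 - theta k)) * ∑ ν ∈ Finset.Icc 1 q, |Ex k r h t q ν| ^ 2)
          ≤ C * (t * γ) ^ ε *
            (γ ^ (1 - theta k) * t ^ (2 * theta k) + t ^ (2 * Delta k)
              + γ ^ (theta k) * t ^ (Delta k))) ∧
      ((∑ q ∈ Finset.Icc 1 ⌊γ⌋₊,
            (q : ℝ) ^ (-(2 - theta k)) * ∑ ν ∈ Finset.Icc 1 q, |Ex k r h t q ν| ^ 2)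
          ≤ C * (t * γ) ^ ε * t ^ (2 * Delta k)) := by
  have hk2 : (2 : ℝ) ≤ k := by exact_mod_cast hk
  have hth0 : 0 ≤ theta k := by rw [theta]; positivity
  have hth : theta k ≤ 1 / 2 := by
    rw [theta]; exact one_div_le_one_div_of_le (by norm_num) hk2
  have hΔ0 : 0 ≤ Delta k := by rw [Delta]; positivity
  have hthD : theta k ≤ Delta k := by
    rw [theta, Delta, div_le_div_iff₀ (by positivity) (by positivity)]; linarith
  obtain ⟨C1, hC1, H1⟩ := exists_sum_sq_Ex_le hk hr h hε
  obtain ⟨C2, hC2, H2⟩ := exists_sum_rpow_neg_mul_sq_Ex_le hk hr h hε (α := 1)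
    (b := 1 - 2 * theta k) (c := 0) (by linarith) (by linarith) (by linarith) (by linarith) le_rfl
  obtain ⟨C3, hC3, H3⟩ := exists_sum_rpow_neg_mul_sq_Ex_le hk hr h hε (α := 1 - theta k)
    (b := 1 - theta k) (c := theta k) (by linarith) (by linarith) (by linarith) (by linarith) hth0
  obtain ⟨C4, hC4, H4⟩ := exists_sum_rpow_neg_mul_sq_Ex_le hk hr h hε (α := 2 - theta k)
    (b := 0) (c := 0) (by linarith) (by linarith) le_rfl (by linarith) le_rfl
  refine ⟨C1 + 2 * C2 + C3 + 3 * C4, fun t γ ht hγ => ?_⟩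
  have ht0 : 0 < t := by linarith
  have hγ0 : 0 < γ := by linarith
  have hΔ2 : t ^ Delta k ≤ t ^ (2 * Delta k) :=
    Real.rpow_le_rpow_of_exponent_le ht (by linarith)
  have hθ2 : t ^ (2 * theta k) ≤ t ^ (2 * Delta k) :=
    Real.rpow_le_rpow_of_exponent_le ht (by linarith)
  have hG : 0 ≤ (t * γ) ^ ε := by positivity
  refine ⟨(H1 t γ ht hγ).trans ?_, ?_, (H3 t γ ht hγ).trans ?_, (H4 t γ ht hγ).trans ?_⟩
  · gcongr
    linarith
  · simp only [one_div, ← Real.rpow_neg_one]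
    refine (H2 t γ ht hγ).trans ?_
    rw [Real.rpow_zero, one_mul]
    have hp : 0 ≤ γ ^ (1 - 2 * theta k) * t ^ (2 * theta k) := by positivity
    calc _ ≤ C2 * (t * γ) ^ ε *
          (2 * (γ ^ (1 - 2 * theta k) * t ^ (2 * theta k) + t ^ (2 * Delta k))) := by
          gcongr
          linarith
      _ = 2 * C2 * (t * γ) ^ ε *
          (γ ^ (1 - 2 * theta k) * t ^ (2 * theta k) + t ^ (2 * Delta k)) := by ring
      _ ≤ _ := by
          gcongr
          linarith
  · gcongr
    linarith
  · rw [Real.rpow_zero, one_mul, one_mul]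
    calc _ ≤ C4 * (t * γ) ^ ε * (3 * t ^ (2 * Delta k)) := by
          gcongr
          linarith
      _ = 3 * C4 * (t * γ) ^ ε * t ^ (2 * Delta k) := by ring
      _ ≤ _ := by
          gcongr
          linarith
end
end

section
/- Let p be a prime, l ≥ 1 an integer and a ∈ ℕ with p ∤ a. Then Σ_{ν=1}^{p^l} e(aν/p^l) · η_𝒦(p^l, ν) equals (1/ζ(k)) · (−1/(p^k − 1)) if l ≤ k, and equals 0 if l > k. (Here ζ is the Riemann zeta function.) -/
open scoped BigOperators Classical

noncomputable section

/-- `e(x) = e^{2πix}`. -/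
def eF (x : ℝ) : ℂ := Complex.exp (2 * Real.pi * Complex.I * x)

/-- The density `η_𝒦(q,a)` of the `k`-free numbers in the residue class `a mod q`. -/
def etaK (k q a : ℕ) : ℝ :=
  ∑' d : ℕ,
    if 1 ≤ d ∧ Nat.gcd q (d ^ k) ∣ a
    then (ArithmeticFunction.moebius d : ℝ) / ((Nat.lcm q (d ^ k) : ℕ) : ℝ)
    else 0

/-- A complete exponential sum over the multiples of a divisor `g` of the modulus `N` vanishes
unless `g = N`. -/
lemma sum_eF_multiples {N a g : ℕ} (hN : 0 < N) (hgN : g ∣ N) (haN : a.Coprime N) :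
    ∑ ν ∈ Finset.Icc 1 N, (if g ∣ ν then eF (((a * ν : ℕ) : ℝ) / (N : ℝ)) else 0)
      = if g = N then 1 else 0 := by
  obtain ⟨M, rfl⟩ := hgN
  have hg : 0 < g := Nat.pos_of_mul_pos_right hN
  have hM : 0 < M := Nat.pos_of_mul_pos_left hN
  have hprim := Complex.isPrimitiveRoot_exp_of_coprime a M hM.ne' haN.coprime_mul_left_right
  set z := Complex.exp (2 * Real.pi * Complex.I * (a / M)) with hz
  have hreindex : ∑ ν ∈ Finset.Icc 1 (g * M),
      (if g ∣ ν then eF (((a * ν : ℕ) : ℝ) / ((g * M : ℕ) : ℝ)) else 0)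
      = ∑ m ∈ Finset.range M, z ^ (m + 1) := by
    rw [← Finset.sum_filter]
    symm
    refine Finset.sum_bij (fun m _ ↦ g * (m + 1)) ?_ ?_ ?_ ?_
    · intro m hm
      rw [Finset.mem_range] at hm
      simp only [Finset.mem_filter, Finset.mem_Icc, dvd_mul_right, and_true]
      exact ⟨Nat.mul_pos hg m.succ_pos, Nat.mul_le_mul_left g hm⟩
    · intro m _ n _ h
      simpa using Nat.eq_of_mul_eq_mul_left hg h
    · intro ν hν
      simp only [Finset.mem_filter, Finset.mem_Icc] at hν
      obtain ⟨⟨h1, h2⟩, n, rfl⟩ := hν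
      have hn : 0 < n := Nat.pos_of_mul_pos_left h1
      have hnM : n ≤ M := Nat.le_of_mul_le_mul_left h2 hg
      exact ⟨n - 1, Finset.mem_range.2 (by omega), by rw [Nat.sub_add_cancel hn]⟩
    · intro m _
      rw [hz, ← Complex.exp_nat_mul, eF]
      congr 1
      have hg' : (g : ℂ) ≠ 0 := by exact_mod_cast hg.ne'
      have hM' : (M : ℂ) ≠ 0 := by exact_mod_cast hM.ne'
      push_cast
      field_simp
  rw [hreindex]
  simp_rw [pow_succ]
  rw [← Finset.sum_mul]
  rcases Nat.lt_or_ge 1 M with h1 | h1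
  · rw [hprim.geom_sum_eq_zero h1, zero_mul, if_neg]
    intro h
    nlinarith
  · obtain rfl : M = 1 := le_antisymm h1 hM
    have hz1 : z = 1 := by simpa using hprim.pow_eq_one
    simp [hz1]

lemma norm_moebius_div_le (d : ℕ) (x : ℝ) :
    ‖(ArithmeticFunction.moebius d : ℝ) / x‖ ≤ 1 / |x| := by
  rw [norm_div, Real.norm_eq_abs, Real.norm_eq_abs]
  gcongr
  exact_mod_cast ArithmeticFunction.abs_moebius_le_one

lemma summable_etaK {k q : ℕ} (hk : 2 ≤ k) (hq : 0 < q) (a : ℕ) :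
    Summable fun d : ℕ ↦ if 1 ≤ d ∧ Nat.gcd q (d ^ k) ∣ a
      then (ArithmeticFunction.moebius d : ℝ) / ((Nat.lcm q (d ^ k) : ℕ) : ℝ) else 0 := by
  refine Summable.of_norm_bounded (Real.summable_one_div_nat_pow.2 (show 1 < k by omega))
    fun d ↦ ?_
  split_ifs with h
  · refine (norm_moebius_div_le d _).trans ?_
    have hd : 0 < d ^ k := pow_pos h.1 k
    rw [Nat.abs_cast]
    have hle : d ^ k ≤ Nat.lcm q (d ^ k) :=
      Nat.le_of_dvd (Nat.lcm_pos hq hd) (Nat.dvd_lcm_right _ _)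
    exact one_div_le_one_div_of_le (by exact_mod_cast hd) (by exact_mod_cast hle)
  · rw [norm_zero]
    positivity

lemma ofReal_etaK (k q a : ℕ) : (etaK k q a : ℂ) =
    ∑' d : ℕ, if 1 ≤ d ∧ Nat.gcd q (d ^ k) ∣ a
      then (ArithmeticFunction.moebius d : ℂ) / ((Nat.lcm q (d ^ k) : ℕ) : ℂ) else 0 := by
  rw [etaK, Complex.ofReal_tsum]
  refine tsum_congr fun d ↦ ?_
  split_ifs <;> simp

/-- The Gauss sum of the `k`-free numbers as a sum over the `d` with `q ∣ d ^ k`. -/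
lemma sum_eF_mul_etaK {k q a : ℕ} (hk : 2 ≤ k) (hq : 0 < q) (haq : a.Coprime q) :
    ∑ ν ∈ Finset.Icc 1 q, eF (((a * ν : ℕ) : ℝ) / (q : ℝ)) * (etaK k q ν : ℂ)
      = ∑' d : ℕ, if q ∣ d ^ k then (ArithmeticFunction.moebius d : ℂ) / (d : ℂ) ^ k else 0 := by
  simp_rw [ofReal_etaK, ← tsum_mul_left]
  rw [← Summable.tsum_finsetSum]
  · refine tsum_congr fun d ↦ ?_
    rcases Nat.eq_zero_or_pos d with rfl | hd
    · simp
    have hterm : ∀ ν : ℕ, eF (((a * ν : ℕ) : ℝ) / (q : ℝ)) *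
        (if 1 ≤ d ∧ Nat.gcd q (d ^ k) ∣ ν
          then (ArithmeticFunction.moebius d : ℂ) / ((Nat.lcm q (d ^ k) : ℕ) : ℂ) else 0)
        = (if Nat.gcd q (d ^ k) ∣ ν then eF (((a * ν : ℕ) : ℝ) / (q : ℝ)) else 0) *
          ((ArithmeticFunction.moebius d : ℂ) / ((Nat.lcm q (d ^ k) : ℕ) : ℂ)) := by
      intro ν
      by_cases h : Nat.gcd q (d ^ k) ∣ ν
      · rw [if_pos ⟨hd, h⟩, if_pos h]
      · rw [if_neg (fun h' ↦ h h'.2), if_neg h, mul_zero, zero_mul]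
    simp_rw [hterm]
    rw [← Finset.sum_mul, sum_eF_multiples hq (Nat.gcd_dvd_left _ _) haq]
    by_cases h : q ∣ d ^ k
    · rw [if_pos (Nat.gcd_eq_left h), if_pos h, Nat.lcm_eq_right h, one_mul, Nat.cast_pow]
    · rw [if_neg (fun h' ↦ h (Nat.gcd_eq_left_iff_dvd.1 h')), if_neg h, zero_mul]
  · intro ν _
    refine Summable.mul_left _ ?_
    refine (Complex.summable_ofReal.2 (summable_etaK hk hq ν)).congr fun d ↦ ?_
    split_ifs <;> simp

lemma summable_moebius_div_pow {k : ℕ} (hk : 2 ≤ k) :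
    Summable fun d : ℕ ↦ (ArithmeticFunction.moebius d : ℂ) / (d : ℂ) ^ k := by
  refine Summable.of_norm_bounded (Real.summable_one_div_nat_pow.2 (show 1 < k by omega))
    fun d ↦ ?_
  have h := norm_moebius_div_le d ((d : ℝ) ^ k)
  rw [abs_of_nonneg (by positivity)] at h
  rw [← Complex.norm_real] at h
  push_cast at h
  exact h

lemma tsum_moebius_div_pow {k : ℕ} (hk : 2 ≤ k) :
    ∑' d : ℕ, (ArithmeticFunction.moebius d : ℂ) / (d : ℂ) ^ k = (riemannZeta k)⁻¹ := by
  have hk' : 1 < (k : ℂ).re := by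
    rw [Complex.natCast_re]
    exact_mod_cast hk
  have h := LSeries_one_mul_Lseries_moebius hk'
  rw [LSeries_one_eq_riemannZeta hk'] at h
  rw [← eq_inv_of_mul_eq_one_right h, LSeries]
  refine tsum_congr fun d ↦ ?_
  rcases eq_or_ne d 0 with rfl | hd
  · simp
  · rw [LSeries.term_of_ne_zero hd, Complex.cpow_natCast]

lemma moebius_prime_mul {p : ℕ} (hp : p.Prime) (m : ℕ) :
    ArithmeticFunction.moebius (p * m)
      = if p ∣ m then 0 else -ArithmeticFunction.moebius m := by
  split_ifs with h
  · refine ArithmeticFunction.moebius_eq_zero_of_not_squarefree fun hsq ↦ ?_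
    exact hp.not_isUnit (hsq p (Nat.mul_dvd_mul_left p h))
  · rw [ArithmeticFunction.isMultiplicative_moebius.map_mul_of_coprime
      ((hp.coprime_iff_not_dvd).2 h), ArithmeticFunction.moebius_apply_prime hp, neg_one_mul]

lemma tsum_moebius_div_pow_of_dvd {k p : ℕ} (hk : 2 ≤ k) (hp : p.Prime) :
    ∑' d : ℕ, (if p ∣ d then (ArithmeticFunction.moebius d : ℂ) / (d : ℂ) ^ k else 0)
      = (riemannZeta k)⁻¹ * (-1 / ((p : ℂ) ^ k - 1)) := by
  set f : ℕ → ℂ := fun d ↦ (ArithmeticFunction.moebius d : ℂ) / (d : ℂ) ^ k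
  set F : ℕ → ℂ := fun d ↦ if p ∣ d then f d else 0
  have hf : Summable f := summable_moebius_div_pow hk
  have hF : Summable F := (hf.indicator {d | p ∣ d}).congr fun d ↦ by
    simp [F, Set.indicator_apply]
  have hinj : Function.Injective fun m : ℕ ↦ p * m := mul_right_injective₀ hp.ne_zero
  have hsupp : Function.support F ⊆ Set.range fun m : ℕ ↦ p * m := by
    intro d hd
    obtain ⟨m, rfl⟩ : p ∣ d := by
      by_contra h
      exact hd (if_neg h)
    exact ⟨m, rfl⟩
  have hmul : ∀ m, F (p * m) = -((p : ℂ) ^ k)⁻¹ * (f m - F m) := by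
    intro m
    simp only [F, f, if_pos (dvd_mul_right p m), moebius_prime_mul hp]
    split_ifs
    · simp
    · push_cast
      rw [mul_pow, sub_zero, ← div_div, div_right_comm, neg_div, div_eq_mul_inv _ ((p : ℂ) ^ k)]
      ring
  have hrec : ∑' d, F d = -((p : ℂ) ^ k)⁻¹ * ((riemannZeta k)⁻¹ - ∑' d, F d) := by
    conv_lhs => rw [← hinj.tsum_eq hsupp]
    simp_rw [hmul]
    rw [tsum_mul_left, hf.tsum_sub hF, tsum_moebius_div_pow hk]
  have hpk : 1 < p ^ k := Nat.one_lt_pow (by omega) hp.one_lt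
  have hp0 : (p : ℂ) ^ k ≠ 0 := by exact_mod_cast (zero_lt_one.trans hpk).ne'
  have hp1 : (p : ℂ) ^ k - 1 ≠ 0 := by
    rw [sub_ne_zero]
    exact_mod_cast hpk.ne'
  change ∑' d, F d = _
  generalize (∑' d, F d) = S at hrec ⊢
  generalize (riemannZeta k)⁻¹ = Z at hrec ⊢
  have hS : (p : ℂ) ^ k * S = S - Z := by
    calc (p : ℂ) ^ k * S = (p : ℂ) ^ k * (-((p : ℂ) ^ k)⁻¹ * (Z - S)) := by rw [← hrec]
      _ = S - Z := by field_simp; ring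
  rw [← mul_div_assoc, eq_div_iff hp1]
  linear_combination hS

lemma prime_pow_dvd_pow_iff_of_squarefree {p l k d : ℕ} (hp : p.Prime) (hl : 1 ≤ l)
    (hd : Squarefree d) : p ^ l ∣ d ^ k ↔ l ≤ k ∧ p ∣ d := by
  constructor
  · intro h
    have hpd : p ∣ d := hp.dvd_of_dvd_pow ((dvd_pow_self p (by omega)).trans h)
    refine ⟨?_, hpd⟩
    obtain ⟨m, rfl⟩ := hpd
    have hm : ¬ p ∣ m := fun hm ↦ hp.not_isUnit (hd p (Nat.mul_dvd_mul_left p hm))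
    rw [mul_pow] at h
    have hcop : (p ^ l).Coprime (m ^ k) := Nat.Coprime.pow _ _ ((hp.coprime_iff_not_dvd).2 hm)
    exact (Nat.pow_dvd_pow_iff_le_right hp.one_lt).1 (hcop.dvd_of_dvd_mul_right h)
  · rintro ⟨hlk, hpd⟩
    exact (pow_dvd_pow p hlk).trans (pow_dvd_pow_of_dvd hpd k)

/-- the Gauss sum of the `k`-free numbers at `a/p^l` equals
`(1/ζ(k))·(−1/(p^k−1))` for `l ≤ k` and vanishes for `l > k`. -/
theorem stmt_6 (k : ℕ) (hk : 2 ≤ k) (p : ℕ) (hp : p.Prime) (l : ℕ) (hl : 1 ≤ l)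
    (a : ℕ) (ha : 1 ≤ a) (hpa : ¬ p ∣ a) :
    ∑ ν ∈ Finset.Icc 1 (p ^ l), eF (((a * ν : ℕ) : ℝ) / ((p : ℝ) ^ l)) * (etaK k (p ^ l) ν : ℂ)
      = if l ≤ k then (riemannZeta (k : ℂ))⁻¹ * (-1 / ((p : ℂ) ^ k - 1)) else 0 := by
  have hcop : a.Coprime (p ^ l) := ((hp.coprime_iff_not_dvd.2 hpa).symm).pow_right l
  have h := sum_eF_mul_etaK hk (pow_pos hp.pos l) hcop
  simp only [Nat.cast_pow p l] at h
  rw [h]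
  have hterm : ∀ d : ℕ,
      (if p ^ l ∣ d ^ k then (ArithmeticFunction.moebius d : ℂ) / (d : ℂ) ^ k else 0)
      = if l ≤ k then
          (if p ∣ d then (ArithmeticFunction.moebius d : ℂ) / (d : ℂ) ^ k else 0) else 0 := by
    intro d
    by_cases hd : Squarefree d
    · rw [← ite_and]
      exact if_congr (prime_pow_dvd_pow_iff_of_squarefree hp hl hd) rfl rfl
    · simp [ArithmeticFunction.moebius_eq_zero_of_not_squarefree hd]
  simp_rw [hterm]
  split_ifs
  · exact tsum_moebius_div_pow_of_dvd hk hp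
  · exact tsum_zero
end
end
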